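/- Let (a_n) be lacunary with constant c > 1, k ≥ 2, f : ℝ^{k−1} → ℝ smooth compactly supported, ρ : ℝ → ℝ smooth compactly supported and non-negative. Let R_k(f,N)(α) denote the k-level correlation sum of (α a_n) and C_k(N) = (1−1/N)···(1−(k−1)/N). Then for every η > 0, the weighted variance V = ∫_ℝ |R_k(f,N)(α) − C_k(N)∫_{ℝ^{k−1}} f(x)dx|² ρ(α) dα satisfies V = O(N^{−1+η}). -/

import Mathlib

open MeasureTheory Filter

/-- The `k`-level correlation sum `R_k(f, (b_n), N)`. -/
noncomputable def corrSum (k N : ℕ) (b : ℕ → ℝ) (f : (Fin (k - 1) → ℝ) → ℝ) : ℝ :=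
  (1 / (N : ℝ)) * ∑' m : Fin (k - 1) → ℤ,
    ∑ x ∈ (Fintype.piFinset fun _ : Fin k => Finset.Icc 1 N).filter
        (fun x => Function.Injective x),
      f (fun i => (N : ℝ) * ((b (x ⟨i.1, by have := i.2; omega⟩)
          - b (x ⟨i.1 + 1, by have := i.2; omega⟩)) - (m i : ℝ)))

/-- `C_k(N) = (1 - 1/N) ⋯ (1 - (k-1)/N)`. -/
noncomputable def Ck (k N : ℕ) : ℝ :=
  ∏ j ∈ Finset.Icc 1 (k - 1), (1 - (j : ℝ) / (N : ℝ))

namespace Lac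

/-! ### Counting: generic lemmas -/

lemma card_le_of_fib {α β γ : Type*} (S : Finset γ) (T : Finset β) (P : β → Finset α)
    (F : β → α → γ) (Q : ℕ) (hS : ∀ l ∈ S, ∃ t ∈ T, ∃ p ∈ P t, l = F t p)
    (hP : ∀ t ∈ T, (P t).card ≤ Q) : S.card ≤ T.card * Q := by
  classical
  have h : S ⊆ T.biUnion (fun t => (P t).image (F t)) := by
    intro l hl
    obtain ⟨t, ht, p, hp, rfl⟩ := hS l hl
    exact Finset.mem_biUnion.2 ⟨t, ht, Finset.mem_image_of_mem _ hp⟩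
  refine (Finset.card_le_card h).trans (Finset.card_biUnion_le_card_mul _ _ _ ?_)
  intro t ht
  exact Finset.card_image_le.trans (hP t ht)

lemma sep_card (S : Finset ℤ) (g : ℤ → ℝ) (e T X : ℝ) (he : 0 < e)
    (hsep : ∀ x ∈ S, ∀ y ∈ S, x < y → e * ((y : ℝ) - x) ≤ |g y - g x|)
    (hX : ∀ x ∈ S, |g x - X| ≤ T) (q : ℕ) (hq : 2 * T / e + 1 ≤ q) : S.card ≤ q := by
  rcases S.eq_empty_or_nonempty with rfl | hne
  · simp
  have hsub : S ⊆ Finset.Icc (S.min' hne) (S.max' hne) := fun x hx =>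
    Finset.mem_Icc.2 ⟨S.min'_le x hx, S.le_max' x hx⟩
  have hc := Finset.card_le_card hsub
  rw [Int.card_Icc] at hc
  have hmn : S.min' hne ≤ S.max' hne := S.min'_le _ (S.max'_mem hne)
  have hT : 0 ≤ T := (abs_nonneg _).trans (hX _ (S.min'_mem hne))
  have key : ((S.max' hne : ℤ) : ℝ) - (S.min' hne : ℤ) ≤ 2 * T / e := by
    rcases hmn.eq_or_lt with h | h
    · rw [h]; simp; positivity
    · have h1 := hsep _ (S.min'_mem hne) _ (S.max'_mem hne) h
      have h2 := abs_le.1 (hX _ (S.min'_mem hne))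
      have h3 := abs_le.1 (hX _ (S.max'_mem hne))
      have h4 : |g (S.max' hne) - g (S.min' hne)| ≤ 2 * T := by
        rw [abs_le]; constructor <;> linarith
      rw [le_div_iff₀ he]; linarith
  have h5 : ((S.max' hne : ℤ) : ℝ) + 1 - (S.min' hne : ℤ) ≤ q := by linarith
  have h6 : (S.max' hne : ℤ) + 1 - (S.min' hne : ℤ) ≤ (q : ℤ) := by exact_mod_cast h5
  omega

lemma sep_card_nat (S : Finset ℕ) (g : ℕ → ℝ) (e T X : ℝ) (he : 0 < e)
    (hsep : ∀ x ∈ S, ∀ y ∈ S, x < y → e * ((y : ℝ) - x) ≤ |g y - g x|)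
    (hX : ∀ x ∈ S, |g x - X| ≤ T) (q : ℕ) (hq : 2 * T / e + 1 ≤ q) : S.card ≤ q := by
  classical
  have := sep_card (S.image (fun n : ℕ => (n : ℤ))) (fun z => g z.toNat) e T X he ?_ ?_ q hq
  · rwa [Finset.card_image_of_injective _ Nat.cast_injective] at this
  · simp only [Finset.mem_image]
    rintro _ ⟨x, hx, rfl⟩ _ ⟨y, hy, rfl⟩ h
    simpa using hsep x hx y hy (by exact_mod_cast h)
  · simp only [Finset.mem_image]
    rintro _ ⟨x, hx, rfl⟩
    simpa using hX x hx

/-! ### Lacunary sequences -/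

structure Lacu (c : ℝ) (a : ℕ → ℝ) : Prop where
  hc : 1 < c
  pos : ∀ n ≥ 1, 0 < a n
  lac : ∀ n ≥ 1, c * a n ≤ a (n + 1)

namespace Lacu
variable {c : ℝ} {a : ℕ → ℝ} (h : Lacu c a)
include h

lemma pow_le (y j : ℕ) (hy : 1 ≤ y) : c ^ j * a y ≤ a (y + j) := by
  induction j with
  | zero => simp
  | succ j ih =>
    have := h.lac (y + j) (by omega)
    have hc := h.hc
    calc c ^ (j + 1) * a y = c * (c ^ j * a y) := by ring
      _ ≤ c * a (y + j) := by gcongr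
      _ ≤ a (y + (j + 1)) := this

lemma mono {y y' : ℕ} (hy : 1 ≤ y) (hyy : y ≤ y') : a y ≤ a y' := by
  obtain ⟨j, rfl⟩ := Nat.exists_eq_add_of_le hyy
  have h1 := h.pow_le y j hy
  have h2 : 1 ≤ c ^ j := one_le_pow₀ h.hc.le
  nlinarith [h.pos y hy]

lemma sep {y y' : ℕ} (hy : 1 ≤ y) (hyy : y ≤ y') :
    (c - 1) * a 1 * ((y' : ℝ) - y) ≤ a y' - a y := by
  obtain ⟨j, rfl⟩ := Nat.exists_eq_add_of_le hyy
  clear hyy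
  induction j with
  | zero => simp
  | succ j ih =>
    have h1 := h.lac (y + j) (by omega)
    have h2 := h.mono (y := 1) (y' := y + j) le_rfl (by omega)
    have hc := h.hc
    have h3 : (c - 1) * a 1 ≤ (c - 1) * a (y + j) := by
      apply mul_le_mul_of_nonneg_left h2; linarith
    have e : a (y + (j + 1)) = a (y + j + 1) := rfl
    rw [e]
    push_cast at ih ⊢
    nlinarith

/-- far indices -/
lemma far {y y' G : ℕ} {V : ℝ} (hy : 1 ≤ y) (hf : y + G < y') (hV : V ≤ c ^ G) :
    V * a y ≤ a y' := by
  have h1 := h.pow_le y G hy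
  have h2 := h.mono (y := y + G) (y' := y') (by omega) hf.le
  have := h.pos y hy
  nlinarith

end Lacu

/-! ### Lists of labelled pairs (label, index, coefficient) -/

variable {ι : Type*}

def lsum (a : ℕ → ℝ) : List (ι × ℕ × ℤ) → ℝ
  | [] => 0
  | p :: t => (p.2.2 : ℝ) * a p.2.1 + lsum a t

def csum (col : ι → Bool) (b : Bool) : List (ι × ℕ × ℤ) → ℤ
  | [] => 0
  | p :: t => (if col p.1 = b then p.2.2 else 0) + csum col b t

def Rel (col : ι → Bool) (p p' : ι × ℕ × ℤ) : Prop :=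
  p.2.1 ≤ p'.2.1 ∧ (col p.1 = col p'.1 → p.2.1 < p'.2.1)

def hcond (a : ℕ → ℝ) (V : ℝ) : List (ι × ℕ × ℤ) → Prop
  | [] => True
  | p :: t => |lsum a (p :: t)| ≤ V * a p.2.1

noncomputable def box (ι : Type*) [Fintype ι] (N W : ℕ) : Finset (ι × ℕ × ℤ) :=
  Finset.univ ×ˢ Finset.Icc 1 N ×ˢ Finset.Icc (-(W : ℤ)) W

open Classical in
noncomputable def Lists (ι : Type*) [Fintype ι] (N W : ℕ) : ℕ → Finset (List (ι × ℕ × ℤ))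
  | 0 => {[]}
  | n + 1 => (box ι N W ×ˢ Lists ι N W n).image (fun x => x.1 :: x.2)

lemma mem_Lists_succ [Fintype ι] {N W n : ℕ} {l : List (ι × ℕ × ℤ)} :
    l ∈ Lists ι N W (n + 1) ↔ ∃ p t, l = p :: t ∧ p ∈ box ι N W ∧ t ∈ Lists ι N W n := by
  simp only [Lists, Finset.mem_image, Finset.mem_product]
  constructor
  · rintro ⟨⟨p, t⟩, h, rfl⟩; exact ⟨_, _, rfl, h.1, h.2⟩
  · rintro ⟨p, t, rfl, h1, h2⟩; exact ⟨⟨p, t⟩, ⟨h1, h2⟩, rfl⟩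

lemma mem_Lists_iff [Fintype ι] {N W n : ℕ} {l : List (ι × ℕ × ℤ)} :
    l ∈ Lists ι N W n ↔ l.length = n ∧ ∀ p ∈ l, p ∈ box ι N W := by
  induction n generalizing l with
  | zero =>
    simp only [Lists, Finset.mem_singleton, List.length_eq_zero_iff]
    constructor
    · rintro rfl; simp
    · exact fun h => h.1
  | succ n ih =>
    rw [mem_Lists_succ]
    constructor
    · rintro ⟨p, t, rfl, hp, ht⟩
      rw [ih] at ht
      simp [ht.1, hp]
      simpa using ht.2
    · rintro ⟨h1, h2⟩
      cases l with
      | nil => simp at h1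
      | cons p t =>
        refine ⟨p, t, rfl, h2 p (by simp), ih.2 ⟨by simpa using h1, fun x hx => h2 x (by simp [hx])⟩⟩

lemma mem_box [Fintype ι] {N W : ℕ} {p : ι × ℕ × ℤ} :
    p ∈ box ι N W ↔ (1 ≤ p.2.1 ∧ p.2.1 ≤ N) ∧ (-(W : ℤ) ≤ p.2.2 ∧ p.2.2 ≤ W) := by
  simp [box]

lemma abs_w_le {W : ℕ} {w : ℤ} (h : -(W : ℤ) ≤ w ∧ w ≤ W) : |(w : ℝ)| ≤ W := by
  have : |w| ≤ (W : ℤ) := abs_le.2 h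
  exact_mod_cast this

open Classical in
noncomputable def X [Fintype ι] (col : ι → Bool) (a : ℕ → ℝ) (N W n : ℕ) (V : ℝ) :
    Finset (List (ι × ℕ × ℤ)) :=
  (Lists ι N W n).filter (fun l => l.Pairwise (Rel col) ∧ hcond a V l)

lemma mem_X [Fintype ι] {col : ι → Bool} {a : ℕ → ℝ} {N W n : ℕ} {V : ℝ}
    {l : List (ι × ℕ × ℤ)} :
    l ∈ X col a N W n V ↔ l ∈ Lists ι N W n ∧ l.Pairwise (Rel col) ∧ hcond a V l := by
  simp [X]

/-- Extending: if the total of `p :: t` is small relative to `a p.y`, the tail is either close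
to `p` and lies in `X n (V + W)`, or lies in `X n 1`. -/
lemma tail_cases [Fintype ι] {col : ι → Bool} {c : ℝ} {a : ℕ → ℝ} (h : Lacu c a) {N W n G : ℕ}
    {V : ℝ} {p : ι × ℕ × ℤ} {t : List (ι × ℕ × ℤ)} (hp : p ∈ box ι N W) (ht : t ∈ Lists ι N W n)
    (hV : V + W ≤ c ^ G) (hV0 : 0 ≤ V)
    (hR : (p :: t).Pairwise (Rel col)) (hs : |lsum a (p :: t)| ≤ V * a p.2.1) :
    (∃ p' t', t = p' :: t' ∧ p' ∈ box ι N W ∧ p.2.1 ≤ p'.2.1 ∧ p'.2.1 ≤ p.2.1 + G ∧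
      t ∈ X col a N W n (V + W)) ∨ t ∈ X col a N W n 1 := by
  rw [List.pairwise_cons] at hR
  rw [mem_box] at hp
  cases t with
  | nil => right; exact mem_X.2 ⟨ht, by simp, by simp [hcond]⟩
  | cons p' t' =>
    have hp' : p' ∈ box ι N W := (mem_Lists_iff.1 ht).2 p' (by simp)
    have hp'b := mem_box.1 hp'
    have hle := (hR.1 p' (by simp)).1
    have hap := h.pos _ hp.1.1
    have hsum : |lsum a (p' :: t')| ≤ (V + W) * a p.2.1 := by
      have e : lsum a (p' :: t') = lsum a (p :: p' :: t') - p.2.2 * a p.2.1 := by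
        simp [lsum]
      rw [e]
      refine (abs_sub _ _).trans ?_
      rw [abs_mul, abs_of_pos hap]
      have := abs_w_le hp.2
      nlinarith
    by_cases hG : p'.2.1 ≤ p.2.1 + G
    · left
      refine ⟨p', t', rfl, hp', hle, hG, mem_X.2 ⟨ht, hR.2, ?_⟩⟩
      refine hsum.trans ?_
      gcongr
      exact h.mono hp.1.1 hle
    · right
      refine mem_X.2 ⟨ht, hR.2, ?_⟩
      refine hsum.trans ?_
      rw [one_mul]
      exact h.far hp.1.1 (by omega) hV

end Lac

namespace Lac
variable {ι : Type*}

/-- Parameters of the counting problem. -/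
structure Params (c : ℝ) (a : ℕ → ℝ) (N W G q M : ℕ) (T : ℝ) : Prop where
  lac : Lacu c a
  hN : N ≤ M
  hW : 2 * W + 1 ≤ M
  hG : G + 1 ≤ q
  hq : 3 ≤ q
  hT : 0 ≤ T
  hqT : 2 * T / min (a 1) ((c - 1) * a 1) + 1 ≤ q

lemma card_split {α : Type*} (S : Finset α) (P : α → Prop) [DecidablePred P] (m n : ℕ)
    (h1 : (S.filter P).card ≤ m) (h2 : (S.filter (fun x => ¬ P x)).card ≤ n) :
    S.card ≤ m + n := by
  rw [← Finset.card_filter_add_card_filter_not (s := S) P]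
  omega

variable {c : ℝ} {a : ℕ → ℝ} {N W G q M : ℕ} {T : ℝ}

namespace Params
variable (H : Params c a N W G q M T)
include H

lemma e0_pos : 0 < min (a 1) ((c - 1) * a 1) := by
  have := H.lac.pos 1 le_rfl
  have h2 := H.lac.hc
  apply lt_min this
  apply mul_pos _ this
  linarith

lemma card_Icc_W : (Finset.Icc (-(W : ℤ)) W).card ≤ M := by
  rw [Int.card_Icc]; have := H.hW; omega

lemma card_Icc_N : (Finset.Icc 1 N).card ≤ M := by
  rw [Nat.card_Icc]; have := H.hN; omega

lemma card_close (y : ℕ) : (Finset.Icc (y - G) y).card ≤ q := by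
  rw [Nat.card_Icc]; have := H.hG; omega

/-- number of extensions with an arbitrary coefficient -/
lemma card_ext [Fintype ι] (Y : Finset ℕ) :
    ((Finset.univ : Finset ι) ×ˢ Y ×ˢ Finset.Icc (-(W : ℤ)) W).card
      ≤ Fintype.card ι * Y.card * M := by
  rw [Finset.card_product, Finset.card_product, Finset.card_univ, mul_assoc]
  gcongr
  exact H.card_Icc_W

open Classical in
/-- number of extensions with a constrained coefficient -/
lemma card_ext' [Fintype ι] (Y : Finset ℕ) (hY : ∀ y ∈ Y, 1 ≤ y) (S : ℝ) :
    (((Finset.univ : Finset ι) ×ˢ Y ×ˢ Finset.Icc (-(W : ℤ)) W).filter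
      (fun p => |(p.2.2 : ℝ) * a p.2.1 + S| ≤ 1 * a p.2.1)).card
      ≤ Fintype.card ι * Y.card * 3 := by
  have := card_le_of_fib
    (S := (((Finset.univ : Finset ι) ×ˢ Y ×ˢ Finset.Icc (-(W : ℤ)) W).filter
      (fun p => |(p.2.2 : ℝ) * a p.2.1 + S| ≤ 1 * a p.2.1)))
    (T := (Finset.univ : Finset ι) ×ˢ Y)
    (P := fun x => (Finset.Icc (-(W : ℤ)) W).filter (fun w : ℤ => |(w : ℝ) * a x.2 + S| ≤ a x.2))
    (F := fun x w => (x.1, x.2, w)) (Q := 3) ?_ ?_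
  · simpa [Finset.card_product] using this
  · rintro ⟨i, y, w⟩ hl
    simp only [Finset.mem_filter, Finset.mem_product, Finset.mem_univ, true_and] at hl
    refine ⟨(i, y), by simpa using hl.1.1, w, ?_, rfl⟩
    simpa using And.intro (Finset.mem_Icc.1 hl.1.2) hl.2
  · rintro ⟨i, y⟩ hy
    simp only [Finset.mem_product, Finset.mem_univ, true_and] at hy
    have hpos := H.lac.pos y (hY y hy)
    refine sep_card _ (fun w => (w : ℝ) * a y) (a y) (a y) (-S) hpos ?_ ?_ 3 ?_
    · intro x _ x' _ hx
      rw [← sub_mul, abs_mul, abs_of_pos hpos, mul_comm]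
      gcongr
      exact le_abs_self _
    · intro x hx
      simpa using (Finset.mem_filter.1 hx).2
    · rw [mul_div_assoc, div_self hpos.ne']; norm_num

/-- Main induction. -/
theorem X_bound [Fintype ι] (col : ι → Bool) (n : ℕ) :
    (∀ V, 0 ≤ V → 1 + V + n * (W + 1) ≤ c ^ G →
      (X col a N W n V).card ≤ (3 * Fintype.card ι * (q + 1)) ^ n * M ^ (n + 1)) ∧
    (1 + n * (W + 1) ≤ c ^ G →
      (X col a N W n 1).card ≤ (3 * Fintype.card ι * (q + 1)) ^ n * M ^ n) := by
  classical
  set ℓ := Fintype.card ι with hℓ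
  set E := 3 * ℓ * (q + 1) with hE
  have hM : 1 ≤ M := by have := H.hW; omega
  induction n with
  | zero =>
    have h0 : ∀ V, (X col a N W 0 V).card ≤ 1 := by
      intro V
      refine (Finset.card_filter_le _ _).trans ?_
      simp [Lists]
    constructor
    · intro V _ _
      simpa using (h0 V).trans hM
    · intro _
      simpa using h0 1
  | succ n ih =>
    obtain ⟨ihA, ihB⟩ := ih
    have hW0 : (0 : ℝ) ≤ W := Nat.cast_nonneg _
    have hn0 : (0 : ℝ) ≤ n * (W + 1) := by positivity
    constructor
    · intro V hV hVG
      push_cast at hVG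
      have hA := ihA (V + W) (by positivity) (by linarith)
      have hVG' : V + W ≤ c ^ G := by linarith
      have hB := ihB (by linarith)
      have key : (X col a N W (n + 1) V).card ≤
          (X col a N W n 1).card * (ℓ * M * M) + (X col a N W n (V + W)).card * (ℓ * q * M) := by
        refine card_split _ (fun l => l.tail ∈ X col a N W n 1) _ _ ?_ ?_
        · refine card_le_of_fib _ (X col a N W n 1) (fun _ => box ι N W) (fun t p => p :: t) _ ?_ ?_
          · intro l hl
            obtain ⟨hl, ht⟩ := Finset.mem_filter.1 hl
            obtain ⟨p, t, rfl, hp, _⟩ := mem_Lists_succ.1 (mem_X.1 hl).1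
            exact ⟨t, ht, p, hp, rfl⟩
          · intro t _
            refine (H.card_ext _).trans ?_
            gcongr
            exact H.card_Icc_N
        · refine card_le_of_fib _ (X col a N W n (V + W))
            (fun t => Finset.univ ×ˢ (Finset.Icc (((t.map (fun p => p.2.1)).headD 0) - G)
              ((t.map (fun p => p.2.1)).headD 0)) ×ˢ Finset.Icc (-(W : ℤ)) W)
            (fun t p => p :: t) _ ?_ ?_
          · intro l hl
            obtain ⟨hl, ht⟩ := Finset.mem_filter.1 hl
            obtain ⟨p, t, rfl, hp, ht'⟩ := mem_Lists_succ.1 (mem_X.1 hl).1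
            rcases tail_cases H.lac hp ht' hVG' hV (mem_X.1 hl).2.1 (mem_X.1 hl).2.2 with h | h
            · obtain ⟨p', t', rfl, hp', h1, h2, h3⟩ := h
              refine ⟨_, h3, p, ?_, rfl⟩
              have := (mem_box.1 hp).2
              simp [h1, this]
              omega
            · exact absurd h ht
          · intro t _
            refine (H.card_ext _).trans ?_
            gcongr
            exact H.card_close _
      calc _ ≤ _ := key
        _ ≤ (E ^ n * M ^ n) * (ℓ * M * M) + (E ^ n * M ^ (n + 1)) * (ℓ * q * M) := by gcongr
        _ = E ^ n * M ^ (n + 2) * (ℓ * (q + 1)) := by ring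
        _ ≤ E ^ n * M ^ (n + 2) * E := by
          gcongr
          rw [hE]; nlinarith [Nat.zero_le (ℓ * (q + 1))]
        _ = E ^ (n + 1) * M ^ (n + 1 + 1) := by ring
    · intro hG1
      push_cast at hG1
      have hA := ihA (1 + W) (by positivity) (by linarith)
      have hVG' : (1 : ℝ) + W ≤ c ^ G := by linarith
      have hB := ihB (by linarith)
      have key : (X col a N W (n + 1) 1).card ≤
          (X col a N W n 1).card * (ℓ * M * 3) + (X col a N W n (1 + W)).card * (ℓ * q * 3) := by
        refine card_split _ (fun l => l.tail ∈ X col a N W n 1) _ _ ?_ ?_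
        · refine card_le_of_fib _ (X col a N W n 1)
            (fun t => (Finset.univ ×ˢ Finset.Icc 1 N ×ˢ Finset.Icc (-(W : ℤ)) W).filter
              (fun p => |(p.2.2 : ℝ) * a p.2.1 + lsum a t| ≤ 1 * a p.2.1))
            (fun t p => p :: t) _ ?_ ?_
          · intro l hl
            obtain ⟨hl, ht⟩ := Finset.mem_filter.1 hl
            obtain ⟨p, t, rfl, hp, _⟩ := mem_Lists_succ.1 (mem_X.1 hl).1
            exact ⟨t, ht, p, Finset.mem_filter.2 ⟨hp, (mem_X.1 hl).2.2⟩, rfl⟩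
          · intro t _
            refine (H.card_ext' _ (fun y hy => (Finset.mem_Icc.1 hy).1) _).trans ?_
            gcongr
            exact H.card_Icc_N
        · refine card_le_of_fib _ (X col a N W n (1 + W))
            (fun t => (Finset.univ ×ˢ ((Finset.Icc (((t.map (fun p => p.2.1)).headD 0) - G)
              ((t.map (fun p => p.2.1)).headD 0)).filter (fun y => 1 ≤ y)) ×ˢ
                Finset.Icc (-(W : ℤ)) W).filter
              (fun p => |(p.2.2 : ℝ) * a p.2.1 + lsum a t| ≤ 1 * a p.2.1))
            (fun t p => p :: t) _ ?_ ?_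
          · intro l hl
            obtain ⟨hl, ht⟩ := Finset.mem_filter.1 hl
            obtain ⟨p, t, rfl, hp, ht'⟩ := mem_Lists_succ.1 (mem_X.1 hl).1
            rcases tail_cases H.lac hp ht' hVG' zero_le_one (mem_X.1 hl).2.1 (mem_X.1 hl).2.2
              with h | h
            · obtain ⟨p', t', rfl, hp', h1, h2, h3⟩ := h
              refine ⟨_, h3, p, Finset.mem_filter.2 ⟨?_, (mem_X.1 hl).2.2⟩, rfl⟩
              have := (mem_box.1 hp)
              simp [h1, this]
              omega
            · exact absurd h ht
          · intro t _
            refine (H.card_ext' _ (fun y hy => (Finset.mem_filter.1 hy).2) _).trans ?_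
            gcongr
            exact (Finset.card_filter_le _ _).trans (H.card_close _)
      calc _ ≤ _ := key
        _ ≤ (E ^ n * M ^ n) * (ℓ * M * 3) + (E ^ n * M ^ (n + 1)) * (ℓ * q * 3) := by gcongr
        _ = E ^ (n + 1) * M ^ (n + 1) := by rw [hE]; ring

end Params
end Lac

namespace Lac
variable {ι : Type*}
variable {c : ℝ} {a : ℕ → ℝ} {N W G q M : ℕ} {T : ℝ}

namespace Params
variable (H : Params c a N W G q M T)
include H

open Classical in
/-- Completions by one element with nonzero coefficient. -/
lemma card_last [Fintype ι] (col : ι → Bool) (t : List (ι × ℕ × ℤ)) :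
    ((box ι N W).filter (fun p => p.2.2 ≠ 0 ∧ (∀ b, csum col b (p :: t) = 0) ∧
      |lsum a (p :: t)| ≤ T)).card ≤ Fintype.card ι * q := by
  rw [← Finset.card_univ]
  refine card_le_of_fib _ Finset.univ
    (fun i => (Finset.Icc 1 N).filter (fun y =>
      csum col (col i) t ≠ 0 ∧ |((-csum col (col i) t : ℤ) : ℝ) * a y + lsum a t| ≤ T))
    (fun i y => (i, y, -csum col (col i) t)) q ?_ ?_
  · rintro ⟨i, y, w⟩ hp
    obtain ⟨hb, hw, hc, hs⟩ := Finset.mem_filter.1 hp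
    have h1 := hc (col i)
    simp only [csum, if_true] at h1
    have h2 : w = -csum col (col i) t := by omega
    simp only at hw
    have hb' := mem_box.1 hb
    refine ⟨i, Finset.mem_univ _, y, ?_, by rw [h2]⟩
    refine Finset.mem_filter.2 ⟨Finset.mem_Icc.2 hb'.1, by omega, ?_⟩
    rw [← h2]
    exact hs
  · intro i _
    set w : ℤ := -csum col (col i) t with hw
    by_cases h0 : w = 0
    · have : csum col (col i) t = 0 := by omega
      simp [this]
    have hwr : (1 : ℝ) ≤ |(w : ℝ)| := by
      have : 1 ≤ |w| := Int.one_le_abs h0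
      exact_mod_cast this
    refine sep_card_nat _ (fun y => (w : ℝ) * a y) (min (a 1) ((c - 1) * a 1)) T (-lsum a t)
      H.e0_pos ?_ ?_ q H.hqT
    · intro x hx x' hx' hxx
      have h1 := H.lac.sep (Finset.mem_Icc.1 (Finset.mem_filter.1 hx).1).1 hxx.le
      have h2 : (0 : ℝ) < x' - x := by
        rw [sub_pos]; exact_mod_cast hxx
      have h3 : min (a 1) ((c - 1) * a 1) * ((x' : ℝ) - x) ≤ a x' - a x := by
        refine le_trans ?_ h1
        gcongr
        exact min_le_right _ _
      rw [← mul_sub, abs_mul]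
      have h4 : a x' - a x ≤ |a x' - a x| := le_abs_self _
      have h5 := abs_nonneg (a x' - a x)
      nlinarith
    · intro x hx
      have := (Finset.mem_filter.1 hx).2.2
      simpa using this

open Classical in
/-- Completions by two close elements. -/
lemma card_last_two [Fintype ι] (col : ι → Bool) (t : List (ι × ℕ × ℤ)) (Y : Finset ℕ) :
    ((box ι N W ×ˢ box ι N W).filter (fun p => p.2.2.1 ∈ Y ∧ p.1.2.1 ≤ p.2.2.1 ∧
      p.2.2.1 ≤ p.1.2.1 + G ∧
      (col p.1.1 = col p.2.1 → p.1.2.1 < p.2.2.1) ∧ (∀ b, csum col b (p.1 :: p.2 :: t) = 0) ∧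
      |lsum a (p.1 :: p.2 :: t)| ≤ T)).card ≤
      Fintype.card ι * Fintype.card ι * Y.card * q * q := by
  have hcard : ((Finset.univ ×ˢ Finset.univ : Finset (ι × ι)) ×ˢ Y ×ˢ Finset.range q).card =
      Fintype.card ι * Fintype.card ι * Y.card * q := by
    simp only [Finset.card_product, Finset.card_univ, Finset.card_range]; ring
  rw [← hcard]
  refine card_le_of_fib _ _
    (fun x => (Finset.Icc (-(W : ℤ)) W).filter (fun w => (1 ≤ x.2.1 - x.2.2 ∧
      (col x.1.1 = col x.1.2 → x.2.1 - x.2.2 < x.2.1)) ∧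
      |((-(csum col (col x.1.1) t + if col x.1.2 = col x.1.1 then w else 0) : ℤ) : ℝ)
        * a (x.2.1 - x.2.2) + ((w : ℝ) * a x.2.1 + lsum a t)| ≤ T))
    (fun x w => ((x.1.1, x.2.1 - x.2.2,
      -(csum col (col x.1.1) t + if col x.1.2 = col x.1.1 then w else 0)),
      (x.1.2, x.2.1, w))) q ?_ ?_
  · rintro ⟨⟨i, y, w⟩, ⟨i', y', w'⟩⟩ hp
    obtain ⟨hb, hY, hle, hG, hcol, hc, hs⟩ := Finset.mem_filter.1 hp
    obtain ⟨hb1, hb2⟩ := Finset.mem_product.1 hb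
    simp only at hY hle hG hcol hb1 hb2
    have h1 := hc (col i)
    simp only [csum, if_true] at h1
    have h2 : w = -(csum col (col i) t + if col i' = col i then w' else 0) := by omega
    have hb1' := mem_box.1 hb1
    have hb2' := mem_box.1 hb2
    simp only at hb1' hb2'
    have hyy : y' - (y' - y) = y := by omega
    have hGq := H.hG
    refine ⟨((i, i'), (y', y' - y)), ?_, w', ?_, ?_⟩
    · simp [hY]; omega
    · refine Finset.mem_filter.2 ⟨Finset.mem_Icc.2 hb2'.2, ?_, ?_⟩
      · simp only [hyy]
        exact ⟨hb1'.1.1, hcol⟩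
      · simp only [hyy]
        rw [← h2]
        exact hs
    · simp only [hyy]
      rw [← h2]
  · rintro ⟨⟨i, i'⟩, y', j⟩ hx
    simp only
    set S := csum col (col i) t
    by_cases hg : 1 ≤ y' - j ∧ (col i = col i' → y' - j < y')
    swap
    · rw [Finset.filter_false_of_mem]
      · simp
      · intro w _ h; exact hg h.1
    have hy' : 1 ≤ y' := by omega
    have hyp := H.lac.pos y' hy'
    have ha1 := H.lac.mono le_rfl hy'
    set δ : ℝ := if col i' = col i then 1 else 0 with hδ
    have hδe : min (a 1) ((c - 1) * a 1) ≤ a y' - δ * a (y' - j) := by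
      by_cases hcol : col i' = col i
      · have h1 := H.lac.sep hg.1 (hg.2 hcol.symm).le
        have h2 : (1 : ℝ) ≤ (y' : ℝ) - ((y' - j : ℕ) : ℝ) := by
          have : y' - j + 1 ≤ y' := hg.2 hcol.symm
          have : ((y' - j : ℕ) : ℝ) + 1 ≤ y' := by exact_mod_cast this
          linarith
        have h3 : 0 ≤ (c - 1) * a 1 := by
          have := H.lac.hc
          have := H.lac.pos 1 le_rfl
          apply mul_nonneg <;> linarith
        simp only [hδ, hcol, if_true, one_mul]
        refine (min_le_right _ _).trans ?_
        nlinarith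
      · simp only [hδ, hcol, if_false, zero_mul, sub_zero]
        exact (min_le_left _ _).trans ha1
    have hrw : ∀ w : ℤ, ((-(S + if col i' = col i then w else 0) : ℤ) : ℝ) * a (y' - j) +
        ((w : ℝ) * a y' + lsum a t) =
        (w : ℝ) * (a y' - δ * a (y' - j)) - ((S : ℝ) * a (y' - j) - lsum a t) := by
      intro w
      by_cases hcol : col i' = col i
      · simp only [hδ, hcol, if_true]; push_cast; ring
      · simp only [hδ, hcol, if_false]; push_cast; ring
    refine sep_card _ (fun w => (w : ℝ) * (a y' - δ * a (y' - j)))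
      (min (a 1) ((c - 1) * a 1)) T ((S : ℝ) * a (y' - j) - lsum a t)
      H.e0_pos ?_ ?_ q H.hqT
    · intro x _ x' _ hxx
      have h2 : (0 : ℝ) < x' - x := by
        rw [sub_pos]; exact_mod_cast hxx
      rw [← sub_mul]
      refine le_trans ?_ (le_abs_self _)
      rw [mul_comm]
      gcongr
    · intro x hx
      have := (Finset.mem_filter.1 hx).2.2
      rw [hrw] at this
      exact this

end Params

def Fcond (col : ι → Bool) (a : ℕ → ℝ) (T : ℝ) (l : List (ι × ℕ × ℤ)) : Prop :=
  l.Pairwise (Rel col) ∧ (∀ b, csum col b l = 0) ∧ |lsum a l| ≤ T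

open Classical in
noncomputable def DD [Fintype ι] (col : ι → Bool) (a : ℕ → ℝ) (N W : ℕ) (T : ℝ) (n : ℕ) :
    Finset (List (ι × ℕ × ℤ)) :=
  (Lists ι N W n).filter (fun l => Fcond col a T l ∧ ∃ p t, l = p :: t ∧ p.2.2 ≠ 0)

open Classical in
noncomputable def FF [Fintype ι] (col : ι → Bool) (a : ℕ → ℝ) (N W : ℕ) (T : ℝ) (n : ℕ) :
    Finset (List (ι × ℕ × ℤ)) :=
  (Lists ι N W n).filter (fun l => Fcond col a T l ∧ ∃ p ∈ l, p.2.2 ≠ 0)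

namespace Params
variable (H : Params c a N W G q M T)
include H

theorem DD_two [Fintype ι] (col : ι → Bool) (n : ℕ)
    (hG : 1 + T / a 1 + (n + 2) * (W + 1) ≤ c ^ G) :
    (DD col a N W T (n + 2)).card ≤
      3 * (3 * Fintype.card ι * (q + 1)) ^ (n + 3) * M ^ (n + 1) := by
  classical
  set ℓ := Fintype.card ι with hℓ
  set E := 3 * ℓ * (q + 1) with hE
  set V := T / a 1 with hVdef
  have ha1 := H.lac.pos 1 le_rfl
  have hT := H.hT
  have hV : 0 ≤ V := by positivity
  have hW0 : (0 : ℝ) ≤ W := Nat.cast_nonneg _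
  have hn0 : (0 : ℝ) ≤ n * (W + 1) := by positivity
  have hA := (H.X_bound col n).1 (V + W + W) (by positivity) (by linarith)
  have hB := (H.X_bound col n).2 (by linarith)
  have hB1 := (H.X_bound col (n + 1)).2 (by push_cast; linarith)
  rw [← hℓ, ← hE] at hA hB hB1
  have struct : ∀ l ∈ (DD col a N W T (n + 2)).filter (fun l => ¬ l.tail ∈ X col a N W (n + 1) 1),
      ∃ p p' t, l = p :: p' :: t ∧ p ∈ box ι N W ∧ p' ∈ box ι N W ∧ p.2.1 ≤ p'.2.1 ∧
        p'.2.1 ≤ p.2.1 + G ∧ (col p.1 = col p'.1 → p.2.1 < p'.2.1) ∧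
        Fcond col a T (p :: p' :: t) ∧
        ((∃ p'' t', t = p'' :: t' ∧ p'' ∈ box ι N W ∧ p'.2.1 ≤ p''.2.1 ∧ p''.2.1 ≤ p'.2.1 + G ∧
          t ∈ X col a N W n (V + W + W)) ∨ t ∈ X col a N W n 1) := by
    intro l hl
    obtain ⟨hl, hnt⟩ := Finset.mem_filter.1 hl
    obtain ⟨hL, hF, -⟩ := Finset.mem_filter.1 hl
    obtain ⟨p, t, rfl, hp, ht⟩ := mem_Lists_succ.1 hL
    have hb := mem_box.1 hp
    have hs : |lsum a (p :: t)| ≤ V * a p.2.1 := by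
      refine hF.2.2.trans ?_
      have := H.lac.mono le_rfl hb.1.1
      calc T = V * a 1 := by rw [hVdef]; field_simp
        _ ≤ _ := by gcongr
    rcases tail_cases H.lac hp ht (by linarith) hV hF.1 hs with h | h
    · obtain ⟨p', t', rfl, hp', h1, h2, h3⟩ := h
      obtain ⟨p2, t'', e, _, ht''⟩ := mem_Lists_succ.1 ht
      simp only [List.cons.injEq] at e
      obtain ⟨-, rfl⟩ := e
      have hR := (List.pairwise_cons.1 hF.1).1 p' (by simp)
      exact ⟨p, p', t', rfl, hp, hp', h1, h2, hR.2, hF,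
        tail_cases H.lac hp' ht'' (by linarith) (by positivity) (mem_X.1 h3).2.1 (mem_X.1 h3).2.2⟩
    · exact absurd h hnt
  have key : (DD col a N W T (n + 2)).card ≤ (X col a N W (n + 1) 1).card * (ℓ * q) +
      ((X col a N W n 1).card * (ℓ * ℓ * M * q * q) +
       (X col a N W n (V + W + W)).card * (ℓ * ℓ * q * q * q)) := by
    refine card_split _ (fun l => l.tail ∈ X col a N W (n + 1) 1) _ _ ?_
      (card_split _ (fun l => l.tail.tail ∈ X col a N W n 1) _ _ ?_ ?_)
    · refine card_le_of_fib _ (X col a N W (n + 1) 1) _ (fun t p => p :: t) _ ?_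
        (fun t _ => H.card_last col t)
      intro l hl
      obtain ⟨hl, ht⟩ := Finset.mem_filter.1 hl
      obtain ⟨hL, hF, p, t, rfl, hw⟩ := Finset.mem_filter.1 hl
      refine ⟨t, ht, p, Finset.mem_filter.2 ⟨(mem_Lists_iff.1 hL).2 p (by simp), hw, hF.2.1, hF.2.2⟩,
        rfl⟩
    · refine card_le_of_fib _ (X col a N W n 1) _
        (fun t (p : (ι × ℕ × ℤ) × (ι × ℕ × ℤ)) => p.1 :: p.2 :: t) (ℓ * ℓ * M * q * q) ?_
        (fun t _ => (H.card_last_two col t (Finset.Icc 1 N)).trans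
          (by gcongr; exact H.card_Icc_N))
      intro l hl
      obtain ⟨hl, ht⟩ := Finset.mem_filter.1 hl
      obtain ⟨p, p', t, rfl, hp, hp', h1, h2, h3, hF, -⟩ := struct l hl
      refine ⟨t, ht, (p, p'), Finset.mem_filter.2 ⟨Finset.mem_product.2 ⟨hp, hp'⟩, ?_, h1, h2, h3,
        hF.2.1, hF.2.2⟩, rfl⟩
      exact Finset.mem_Icc.2 (mem_box.1 hp').1
    · refine card_le_of_fib _ (X col a N W n (V + W + W)) _
        (fun t (p : (ι × ℕ × ℤ) × (ι × ℕ × ℤ)) => p.1 :: p.2 :: t) (ℓ * ℓ * q * q * q) ?_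
        (fun t _ => (H.card_last_two col t (Finset.Icc (((t.map (fun p => p.2.1)).headD 0) - G)
              ((t.map (fun p => p.2.1)).headD 0))).trans
          (by gcongr; exact H.card_close _))
      intro l hl
      obtain ⟨hl, ht⟩ := Finset.mem_filter.1 hl
      obtain ⟨p, p', t, rfl, hp, hp', h1, h2, h3, hF, h | h⟩ := struct l hl
      · obtain ⟨p'', t', rfl, _, h4, h5, h6⟩ := h
        refine ⟨_, h6, (p, p'), Finset.mem_filter.2 ⟨Finset.mem_product.2 ⟨hp, hp'⟩, ?_, h1, h2, h3,
          hF.2.1, hF.2.2⟩, rfl⟩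
        simp [h4, h5]
      · exact absurd h ht
  calc _ ≤ _ := key
    _ ≤ (E ^ (n + 1) * M ^ (n + 1)) * (ℓ * q) + ((E ^ n * M ^ n) * (ℓ * ℓ * M * q * q) +
       (E ^ n * M ^ (n + 1)) * (ℓ * ℓ * q * q * q)) := by gcongr
    _ = E ^ n * M ^ (n + 1) * (E * (ℓ * q) + (ℓ * q) * (ℓ * q) + (ℓ * ℓ * q * q * q)) := by ring
    _ ≤ E ^ n * M ^ (n + 1) * (E ^ 3 + E ^ 3 + E ^ 3) := by
      have hq := H.hq
      have h1 : ℓ * q ≤ E := by rw [hE]; nlinarith [Nat.zero_le ℓ, Nat.zero_le (ℓ * q)]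
      have h2 : E ^ 2 ≤ E ^ 3 := by
        rcases Nat.eq_zero_or_pos E with h | h
        · simp [h]
        · exact Nat.pow_le_pow_right h (by norm_num)
      have h3 : ℓ * ℓ * q * q * q ≤ (ℓ * q) ^ 3 := by
        rcases Nat.eq_zero_or_pos ℓ with h | h
        · simp [h]
        · calc ℓ * ℓ * q * q * q = ℓ * ℓ * q * q * q * 1 := by ring
            _ ≤ ℓ * ℓ * q * q * q * ℓ := by gcongr; exact h
            _ = _ := by ring
      gcongr
      · refine le_trans ?_ h2
        rw [pow_two]; gcongr
      · refine le_trans ?_ h2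
        rw [pow_two]; gcongr
      · exact h3.trans (by gcongr)
    _ = 3 * E ^ (n + 3) * M ^ (n + 1) := by ring

theorem DD_bound [Fintype ι] (col : ι → Bool) (n : ℕ)
    (hG : 1 + T / a 1 + n * (W + 1) ≤ c ^ G) :
    (DD col a N W T n).card * M ≤ 3 * (3 * Fintype.card ι * (q + 1)) ^ (n + 1) * M ^ n := by
  classical
  match n, hG with
  | 0, _ =>
    have : DD col a N W T 0 = ∅ := by
      rw [Finset.eq_empty_iff_forall_notMem]
      intro l hl
      obtain ⟨hL, hF, p, t, rfl, hw⟩ := Finset.mem_filter.1 hl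
      have := (mem_Lists_iff.1 hL).1
      simp at this
    simp [this]
  | 1, _ =>
    have : DD col a N W T 1 = ∅ := by
      rw [Finset.eq_empty_iff_forall_notMem]
      intro l hl
      obtain ⟨hL, hF, p, t, rfl, hw⟩ := Finset.mem_filter.1 hl
      have h1 := (mem_Lists_iff.1 hL).1
      have h2 : t = [] := by simpa using h1
      subst h2
      have h3 := hF.2.1 (col p.1)
      simp [csum] at h3
      exact hw h3
    simp [this]
  | n + 2, hG =>
    have := H.DD_two col n (by push_cast at hG; exact hG)
    calc _ ≤ _ := Nat.mul_le_mul_right M this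
      _ = _ := by ring

theorem FF_bound [Fintype ι] (col : ι → Bool) (n : ℕ)
    (hG : 1 + T / a 1 + n * (W + 1) ≤ c ^ G) :
    (FF col a N W T n).card * M ≤ 3 * n * (3 * Fintype.card ι * (q + 1)) ^ (n + 1) * M ^ n := by
  classical
  induction n with
  | zero =>
    have : FF col a N W T 0 = ∅ := by
      rw [Finset.eq_empty_iff_forall_notMem]
      intro l hl
      obtain ⟨hL, hF, p, hp, hw⟩ := Finset.mem_filter.1 hl
      have := (mem_Lists_iff.1 hL).1
      rw [List.length_eq_zero_iff] at this
      subst this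
      simp at hp
    simp [this]
  | succ n ih =>
    have hW0 : (0 : ℝ) ≤ W := Nat.cast_nonneg _
    have hD := H.DD_bound col (n + 1) hG
    push_cast at hG
    have hF := ih (by linarith)
    set ℓ := Fintype.card ι with hℓ
    set E := 3 * ℓ * (q + 1) with hE
    have key : (FF col a N W T (n + 1)).card ≤ (FF col a N W T n).card * (ℓ * M) +
        (DD col a N W T (n + 1)).card := by
      refine card_split _ (fun l => ∃ p t, l = p :: t ∧ p.2.2 = 0) _ _ ?_ ?_
      · refine card_le_of_fib _ (FF col a N W T n)
          (fun t => (Finset.univ ×ˢ Finset.Icc 1 N ×ˢ {0}))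
          (fun t p => p :: t) _ ?_ ?_
        · intro l hl
          obtain ⟨hl, p, t, rfl, hp0⟩ := Finset.mem_filter.1 hl
          obtain ⟨hL, hF, p', hp', hw⟩ := Finset.mem_filter.1 hl
          have hL' := mem_Lists_iff.1 hL
          have hb := mem_box.1 (hL'.2 p (by simp))
          refine ⟨t, Finset.mem_filter.2 ⟨mem_Lists_iff.2 ⟨by simpa using hL'.1,
            fun x hx => hL'.2 x (by simp [hx])⟩, ⟨(List.pairwise_cons.1 hF.1).2, ?_, ?_⟩, ?_⟩,
            p, ?_, rfl⟩
          · intro b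
            have := hF.2.1 b
            simpa [csum, hp0] using this
          · have := hF.2.2
            simpa [lsum, hp0] using this
          · rcases List.mem_cons.1 hp' with rfl | h
            · exact absurd hp0 hw
            · exact ⟨p', h, hw⟩
          · simp only [Finset.mem_product, Finset.mem_univ, true_and, Finset.mem_Icc,
              Finset.mem_singleton]
            exact ⟨hb.1, hp0⟩
        · intro t _
          simp only [Finset.card_product, Finset.card_univ, Finset.card_singleton, mul_one]
          gcongr
          exact H.card_Icc_N
      · refine Finset.card_le_card ?_
        intro l hl
        obtain ⟨hl, hn⟩ := Finset.mem_filter.1 hl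
        obtain ⟨hL, hF, p', hp', hw⟩ := Finset.mem_filter.1 hl
        obtain ⟨p, t, rfl, -, -⟩ := mem_Lists_succ.1 hL
        exact Finset.mem_filter.2 ⟨hL, hF, p, t, rfl, fun h0 => hn ⟨p, t, rfl, h0⟩⟩
    calc (FF col a N W T (n + 1)).card * M
        ≤ ((FF col a N W T n).card * (ℓ * M) + (DD col a N W T (n + 1)).card) * M := by gcongr
      _ = ((FF col a N W T n).card * M) * (ℓ * M) + (DD col a N W T (n + 1)).card * M := by ring
      _ ≤ (3 * n * E ^ (n + 1) * M ^ n) * (E * M) + 3 * E ^ (n + 1 + 1) * M ^ (n + 1) := by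
        gcongr
        rw [hE]; nlinarith [Nat.zero_le ℓ, Nat.zero_le (ℓ * q)]
      _ = _ := by ring

end Params
end Lac

namespace Lac
variable {ι : Type*}

noncomputable def slist [Fintype ι] (z : ι → ℕ × ℤ) : List (ι × ℕ × ℤ) :=
  ((Finset.univ : Finset ι).toList.map (fun i => (i, z i))).insertionSort
    (fun p p' => p.2.1 ≤ p'.2.1)

lemma slist_perm [Fintype ι] (z : ι → ℕ × ℤ) :
    (slist z).Perm ((Finset.univ : Finset ι).toList.map (fun i => (i, z i))) :=
  List.perm_insertionSort _ _

lemma mem_slist [Fintype ι] {z : ι → ℕ × ℤ} {p : ι × ℕ × ℤ} : p ∈ slist z ↔ p.2 = z p.1 := by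
  rw [(slist_perm z).mem_iff]
  simp only [List.mem_map, Finset.mem_toList, Finset.mem_univ, true_and]
  constructor
  · rintro ⟨i, rfl⟩; rfl
  · intro h; exact ⟨p.1, by rw [← h]⟩

lemma slist_injective [Fintype ι] : Function.Injective (slist : (ι → ℕ × ℤ) → _) := by
  intro z z' h
  funext i
  have h1 : (i, z i) ∈ slist z := mem_slist.2 rfl
  rw [h] at h1
  exact mem_slist.1 h1

lemma lsum_eq (a : ℕ → ℝ) (l : List (ι × ℕ × ℤ)) :
    lsum a l = (l.map (fun p => (p.2.2 : ℝ) * a p.2.1)).sum := by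
  induction l with
  | nil => simp [lsum]
  | cons p t ih => simp [lsum, ih]

lemma csum_eq (col : ι → Bool) (b : Bool) (l : List (ι × ℕ × ℤ)) :
    csum col b l = (l.map (fun p => if col p.1 = b then p.2.2 else 0)).sum := by
  induction l with
  | nil => simp [csum]
  | cons p t ih => simp [csum, ih]

lemma lsum_slist [Fintype ι] (a : ℕ → ℝ) (z : ι → ℕ × ℤ) :
    lsum a (slist z) = ∑ i, ((z i).2 : ℝ) * a (z i).1 := by
  rw [lsum_eq, ((slist_perm z).map _).sum_eq, List.map_map, Finset.sum_map_toList]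
  rfl

lemma csum_slist [Fintype ι] (col : ι → Bool) (b : Bool) (z : ι → ℕ × ℤ) :
    csum col b (slist z) = ∑ i, if col i = b then (z i).2 else 0 := by
  rw [csum_eq, ((slist_perm z).map _).sum_eq, List.map_map, Finset.sum_map_toList]
  rfl

lemma slist_pairwise [Fintype ι] (col : ι → Bool) (z : ι → ℕ × ℤ)
    (hz : ∀ i j, i ≠ j → col i = col j → (z i).1 ≠ (z j).1) :
    (slist z).Pairwise (Rel col) := by
  have h1 : (slist z).Pairwise (fun p p' => p.2.1 ≤ p'.2.1) := by
    have : Std.Total (fun p p' : ι × ℕ × ℤ => p.2.1 ≤ p'.2.1) := ⟨fun p p' => le_total _ _⟩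
    have : IsTrans _ (fun p p' : ι × ℕ × ℤ => p.2.1 ≤ p'.2.1) := ⟨fun p p' p'' => le_trans⟩
    exact List.pairwise_insertionSort _ _
  have h2 : (slist z).Pairwise (fun p p' => p.1 ≠ p'.1) := by
    have : ((slist z).map Prod.fst).Nodup := by
      rw [((slist_perm z).map _).nodup_iff, List.map_map]
      have : (Prod.fst ∘ fun i => (i, z i)) = (id : ι → ι) := rfl
      rw [this, List.map_id]
      exact Finset.nodup_toList _
    exact List.pairwise_map.1 this
  refine (h1.and h2).imp_of_mem ?_
  intro p p' hp hp' h
  refine ⟨h.1, fun hcol => lt_of_le_of_ne h.1 ?_⟩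
  have := hz p.1 p'.1 h.2 hcol
  have hpq := mem_slist.1 hp'
  rw [mem_slist.1 hp, hpq]
  exact this

/-- Counting quadruples. -/
theorem count_bound {c : ℝ} {a : ℕ → ℝ} {N W G q M : ℕ} {T : ℝ} (H : Params c a N W G q M T)
    (k : ℕ) (hG : 1 + T / a 1 + (2 * k : ℕ) * (W + 1) ≤ c ^ G)
    (S : Finset ((Fin k → ℕ) × (Fin k → ℤ) × (Fin k → ℕ) × (Fin k → ℤ)))
    (hS : ∀ s ∈ S, (∀ i, 1 ≤ s.1 i ∧ s.1 i ≤ N) ∧ (∀ i, 1 ≤ s.2.2.1 i ∧ s.2.2.1 i ≤ N) ∧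
      s.1.Injective ∧ s.2.2.1.Injective ∧ (∀ i, -(W : ℤ) ≤ s.2.1 i ∧ s.2.1 i ≤ W) ∧
      (∀ i, -(W : ℤ) ≤ s.2.2.2 i ∧ s.2.2.2 i ≤ W) ∧ ∑ i, s.2.1 i = 0 ∧ ∑ i, s.2.2.2 i = 0 ∧
      s.2.1 ≠ 0 ∧ |∑ i, (s.2.1 i : ℝ) * a (s.1 i) + ∑ i, (s.2.2.2 i : ℝ) * a (s.2.2.1 i)| ≤ T) :
    S.card * M ≤ 3 * (2 * k) * (3 * (2 * k) * (q + 1)) ^ (2 * k + 1) * M ^ (2 * k) := by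
  classical
  have h := H.FF_bound (ι := Fin k ⊕ Fin k) Sum.isLeft (2 * k) hG
  have hcard : Fintype.card (Fin k ⊕ Fin k) = 2 * k := by simp; ring
  rw [hcard] at h
  refine le_trans (Nat.mul_le_mul_right M ?_) h
  let Φ : ((Fin k → ℕ) × (Fin k → ℤ) × (Fin k → ℕ) × (Fin k → ℤ)) → (Fin k ⊕ Fin k → ℕ × ℤ) :=
    fun s => Sum.elim (fun i => (s.1 i, s.2.1 i)) (fun i => (s.2.2.1 i, s.2.2.2 i))
  have hΦ : Function.Injective Φ := by
    rintro ⟨x, u, x', u'⟩ ⟨y, v, y', v'⟩ he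
    have e1 : ∀ i, x i = y i ∧ u i = v i := fun i => by
      simpa [Φ] using congrFun he (Sum.inl i)
    have e2 : ∀ i, x' i = y' i ∧ u' i = v' i := fun i => by
      simpa [Φ] using congrFun he (Sum.inr i)
    simp only [Prod.mk.injEq]
    exact ⟨funext fun i => (e1 i).1, funext fun i => (e1 i).2, funext fun i => (e2 i).1,
      funext fun i => (e2 i).2⟩
  refine Finset.card_le_card_of_injOn (fun s => slist (Φ s)) ?_
    ((slist_injective.comp hΦ).injOn)
  intro s hs
  obtain ⟨h1, h2, h3, h4, h5, h6, h7, h8, h9, h10⟩ := hS s hs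
  refine Finset.mem_coe.2 (Finset.mem_filter.2 ⟨mem_Lists_iff.2 ⟨?_, ?_⟩, ⟨?_, ?_, ?_⟩, ?_⟩)
  · rw [(slist_perm _).length_eq]; simp; ring
  · rintro ⟨i, p⟩ hp
    have := mem_slist.1 hp
    simp only at this
    subst this
    rw [mem_box]
    cases i with
    | inl i => exact ⟨h1 i, h5 i⟩
    | inr i => exact ⟨h2 i, h6 i⟩
  · apply slist_pairwise
    rintro (i | i) (j | j) hij hcol
    · intro he; exact hij (by rw [h3 he])
    · simp at hcol
    · simp at hcol
    · intro he; exact hij (by rw [h4 he])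
  · intro b
    rw [csum_slist, Fintype.sum_sum_type]
    cases b <;> simp [Φ, h7, h8]
  · rw [lsum_slist, Fintype.sum_sum_type]
    simpa [Φ] using h10
  · obtain ⟨i, hi⟩ := Function.ne_iff.1 h9
    exact ⟨(Sum.inl i, Φ s (Sum.inl i)), mem_slist.2 rfl, by simpa [Φ] using hi⟩

end Lac

namespace Lac

/-- The asymptotic form of the counting bound. -/
theorem count_asymp {c : ℝ} {a : ℕ → ℝ} (h : Lacu c a) (k : ℕ) (hk : 1 ≤ k) (ε : ℝ) (hε : 0 < ε)
    (hε1 : ε ≤ 1) :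
    ∃ K : ℝ, 0 < K ∧ ∀ N W : ℕ, 1 ≤ N → W = 2 * ⌈(N : ℝ) ^ (1 + ε)⌉₊ →
    ∀ (S : Finset ((Fin k → ℕ) × (Fin k → ℤ) × (Fin k → ℕ) × (Fin k → ℤ)))
    (_ : ∀ s ∈ S, (∀ i, 1 ≤ s.1 i ∧ s.1 i ≤ N) ∧ (∀ i, 1 ≤ s.2.2.1 i ∧ s.2.2.1 i ≤ N) ∧
      s.1.Injective ∧ s.2.2.1.Injective ∧ (∀ i, -(W : ℤ) ≤ s.2.1 i ∧ s.2.1 i ≤ W) ∧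
      (∀ i, -(W : ℤ) ≤ s.2.2.2 i ∧ s.2.2.2 i ≤ W) ∧ ∑ i, s.2.1 i = 0 ∧ ∑ i, s.2.2.2 i = 0 ∧
      s.2.1 ≠ 0 ∧ |∑ i, (s.2.1 i : ℝ) * a (s.1 i) + ∑ i, (s.2.2.2 i : ℝ) * a (s.2.2.1 i)|
        ≤ (N : ℝ) ^ ε),
    (S.card : ℝ) ≤ K * (N : ℝ) ^ (2 * (k : ℝ) - 1 + 4 * k * ε) := by
  have ha1 := h.pos 1 le_rfl
  have hc := h.hc
  have hlogc : 0 < Real.log c := Real.log_pos hc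
  set e0 := min (a 1) ((c - 1) * a 1) with he0
  have he0p : 0 < e0 := lt_min ha1 (mul_pos (by linarith) ha1)
  set K1 : ℝ := 1 + 1 / a 1 + 10 * k with hK1
  have hK1p : 1 ≤ K1 := by
    have : 0 ≤ 1 / a 1 + 10 * (k : ℝ) := by positivity
    linarith
  set K5 : ℝ := 7 + (Real.log K1 / Real.log c + 2 / (ε * Real.log c)) + 2 / e0 with hK5
  have hlK1 : 0 ≤ Real.log K1 := Real.log_nonneg hK1p
  have hK5p : 0 < K5 := by positivity
  refine ⟨3 * (2 * k) * (3 * (2 * k) * (K5 + 1)) ^ (2 * k + 1) * 9 ^ (2 * k - 1), by positivity, ?_⟩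
  intro N W hN hW S hS
  have hNr : (1 : ℝ) ≤ N := by exact_mod_cast hN
  have hN0 : (0 : ℝ) < N := by linarith
  set B : ℝ := (N : ℝ) ^ (1 + ε) with hB
  set Q : ℝ := (N : ℝ) ^ ε with hQ
  have hB1 : 1 ≤ B := Real.one_le_rpow hNr (by linarith)
  have hQ1 : 1 ≤ Q := Real.one_le_rpow hNr hε.le
  have hNB : (N : ℝ) ≤ B := by
    calc (N : ℝ) = (N : ℝ) ^ (1 : ℝ) := (Real.rpow_one _).symm
      _ ≤ _ := Real.rpow_le_rpow_of_exponent_le hNr (by linarith)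
  have hQB : Q ≤ B := Real.rpow_le_rpow_of_exponent_le hNr (by linarith)
  have hBN2 : B ≤ (N : ℝ) ^ (2 : ℝ) := Real.rpow_le_rpow_of_exponent_le hNr (by linarith)
  have hceil : (⌈B⌉₊ : ℝ) ≤ B + 1 := (Nat.ceil_lt_add_one (by linarith)).le
  have hceil' : B ≤ (⌈B⌉₊ : ℝ) := Nat.le_ceil _
  have hWr : (W : ℝ) ≤ 4 * B := by
    rw [hW]; push_cast; linarith
  set M : ℕ := 2 * W + 1 with hM
  have hMr : (M : ℝ) ≤ 9 * B := by rw [hM]; push_cast; linarith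
  set G : ℕ := ⌈Real.log (K1 * (N : ℝ) ^ (2 : ℝ)) / Real.log c⌉₊ with hGdef
  have hlogN : Real.log N ≤ Q / ε := Real.log_le_rpow_div hN0.le hε
  have hlogeq : Real.log (K1 * (N : ℝ) ^ (2 : ℝ)) = Real.log K1 + 2 * Real.log N := by
    rw [Real.log_mul (by positivity) (by positivity), Real.log_rpow hN0]
  have hlogN0 : 0 ≤ Real.log N := Real.log_nonneg hNr
  have hGr : (G : ℝ) ≤ (Real.log K1 / Real.log c + 2 / (ε * Real.log c)) * Q + 1 := by
    refine (Nat.ceil_lt_add_one ?_).le.trans ?_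
    · rw [hlogeq]; positivity
    · rw [hlogeq, add_div]
      have h1 : Real.log K1 / Real.log c ≤ Real.log K1 / Real.log c * Q :=
        le_mul_of_one_le_right (by positivity) hQ1
      have h2 : 2 * Real.log N / Real.log c ≤ 2 / (ε * Real.log c) * Q := by
        calc 2 * Real.log N / Real.log c ≤ 2 * (Q / ε) / Real.log c := by gcongr
          _ = _ := by field_simp
      linarith
  have hGpow : K1 * (N : ℝ) ^ (2 : ℝ) ≤ c ^ G := by
    have h1 : Real.log (K1 * (N : ℝ) ^ (2 : ℝ)) ≤ G * Real.log c := by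
      rw [← div_le_iff₀ hlogc]; exact Nat.le_ceil _
    rw [← Real.log_pow] at h1
    exact (Real.log_le_log_iff (by positivity) (by positivity)).1 h1
  set q : ℕ := 3 + (G + 1) + ⌈2 * Q / e0 + 1⌉₊ with hq
  have hqr : (q : ℝ) ≤ K5 * Q := by
    have h1 : (⌈2 * Q / e0 + 1⌉₊ : ℝ) ≤ 2 * Q / e0 + 1 + 1 :=
      (Nat.ceil_lt_add_one (by positivity)).le
    rw [hq]; push_cast
    have h2 : 2 * Q / e0 = 2 / e0 * Q := by ring
    rw [hK5]; nlinarith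
  have H : Params c a N W G q M Q := by
    refine ⟨h, ?_, le_rfl, by omega, by omega, by linarith, ?_⟩
    · have : (N : ℝ) ≤ M := by
        rw [hM, hW]; push_cast; linarith
      exact_mod_cast this
    · refine (Nat.le_ceil _).trans ?_
      rw [← he0]
      rw [hq]; push_cast
      have : (0 : ℝ) ≤ G := Nat.cast_nonneg _
      linarith
  have hGG : 1 + Q / a 1 + (2 * k : ℕ) * ((W : ℝ) + 1) ≤ c ^ G := by
    refine le_trans ?_ hGpow
    calc 1 + Q / a 1 + (2 * k : ℕ) * ((W : ℝ) + 1)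
        ≤ 1 * B + B / a 1 + 2 * k * (5 * B) := by
          push_cast
          gcongr <;> linarith
      _ = K1 * B := by rw [hK1]; ring
      _ ≤ _ := by gcongr
  have hmain := count_bound H k hGG S hS
  have hMpos : (0 : ℝ) < M := by rw [hM]; positivity
  have hmain' : (S.card : ℝ) * M ≤
      3 * (2 * k) * (3 * (2 * k) * (q + 1)) ^ (2 * k + 1) * M ^ (2 * k) := by exact_mod_cast hmain
  obtain ⟨j, hj⟩ : ∃ j, 2 * k = j + 1 := ⟨2 * k - 1, by omega⟩
  have hj' : 2 * k - 1 = j := by omega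
  have h1 : (S.card : ℝ) ≤ 3 * (2 * k) * (3 * (2 * k) * (q + 1)) ^ (2 * k + 1) * M ^ j := by
    have e : (M : ℝ) ^ (2 * k) = M ^ j * M := by rw [hj, pow_succ]
    rw [e, ← mul_assoc] at hmain'
    exact le_of_mul_le_mul_right hmain' hMpos
  have hjr : (j : ℝ) = 2 * k - 1 := by
    have : ((2 * k : ℕ) : ℝ) = j + 1 := by rw [hj]; push_cast; ring
    push_cast at this; linarith
  calc (S.card : ℝ) ≤ _ := h1
    _ ≤ 3 * (2 * k) * (3 * (2 * k) * ((K5 + 1) * Q)) ^ (2 * k + 1) * (9 * B) ^ j := by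
      gcongr
      linarith
    _ = 3 * (2 * k) * (3 * (2 * k) * (K5 + 1)) ^ (2 * k + 1) * 9 ^ j * (Q ^ (2 * k + 1) * B ^ j) := by
      rw [mul_pow 9 B, ← mul_assoc (3 * (2 * (k : ℝ))) (K5 + 1) Q,
        mul_pow (3 * (2 * (k : ℝ)) * (K5 + 1)) Q]; ring
    _ = _ := by
      rw [hj']
      congr 1
      rw [hQ, hB, ← Real.rpow_natCast, ← Real.rpow_natCast, ← Real.rpow_mul hN0.le,
        ← Real.rpow_mul hN0.le, ← Real.rpow_add hN0]
      congr 1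
      rw [hjr]; push_cast; ring

end Lac

namespace Lac

/-- Fourier transform on `Fin d → ℝ`. -/
noncomputable def gF {d : ℕ} (f : (Fin d → ℝ) → ℝ) (ξ : Fin d → ℝ) : ℂ :=
  ∫ x : Fin d → ℝ, Complex.exp ((-2 * Real.pi * ∑ i, ξ i * x i : ℝ) * Complex.I) * (f x : ℂ)

open scoped FourierTransform in
theorem gF_decay {d : ℕ} (f : (Fin d → ℝ) → ℝ) (hf1 : ContDiff ℝ (⊤ : ℕ∞) f)
    (hf2 : HasCompactSupport f) (J : ℕ) :
    ∃ C : ℝ, 0 < C ∧ ∀ ξ, ‖ξ‖ ^ J * ‖gF f ξ‖ ≤ C := by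
  let h : EuclideanSpace ℝ (Fin d) → ℂ := fun x => (f (WithLp.ofLp x) : ℂ)
  have h1 : ContDiff ℝ (⊤ : ℕ∞) h := by
    refine Complex.ofRealCLM.contDiff.comp (hf1.comp ?_)
    exact (PiLp.continuousLinearEquiv 2 ℝ (fun _ : Fin d => ℝ)).contDiff
  have h2 : HasCompactSupport h := by
    have := hf2.comp_homeomorph (PiLp.continuousLinearEquiv 2 ℝ (fun _ : Fin d => ℝ)).toHomeomorph
    exact this.comp_left (g := fun x : ℝ => (x : ℂ)) (by simp)
  obtain ⟨C, hC⟩ := (𝓕 (h2.toSchwartzMap h1)).decay J 0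
  refine ⟨C, hC.1, fun ξ => ?_⟩
  have h3 := hC.2 (WithLp.toLp 2 ξ)
  rw [norm_iteratedFDeriv_zero] at h3
  have h4 : (𝓕 (h2.toSchwartzMap h1)) (WithLp.toLp 2 ξ) = gF f ξ := by
    rw [SchwartzMap.fourier_coe, Real.fourier_eq', gF]
    have := (PiLp.volume_preserving_ofLp (Fin d)).integral_comp
      (MeasurableEquiv.toLp 2 (Fin d → ℝ)).symm.measurableEmbedding
      (fun x : Fin d → ℝ => Complex.exp ((-2 * Real.pi * ∑ i, ξ i * x i : ℝ) * Complex.I) * (f x : ℂ))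
    rw [← this]
    refine integral_congr_ae (Eventually.of_forall fun x => ?_)
    simp [PiLp.inner_apply, h, HasCompactSupport.toSchwartzMap]
    rfl
  rw [h4] at h3
  refine le_trans ?_ h3
  gcongr
  refine (pi_norm_le_iff_of_nonneg (norm_nonneg _)).2 fun i => ?_
  exact PiLp.norm_apply_le (WithLp.toLp 2 ξ) i

end Lac

namespace Lac

theorem box_support {d : ℕ} {φ : (Fin d → ℝ) → ℂ} (h2 : HasCompactSupport φ) (B : ℝ) :
    ∃ T : Finset (Fin d → ℤ), ∀ θ : Fin d → ℝ, ‖θ‖ ≤ B → ∀ m : Fin d → ℤ, m ∉ T →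
      φ (fun i => θ i - m i) = 0 := by
  obtain ⟨R, hR⟩ := h2.isCompact.isBounded.subset_closedBall 0
  refine ⟨Fintype.piFinset fun _ => Finset.Icc (-⌈R + B⌉) ⌈R + B⌉, fun θ hθ m hm => ?_⟩
  by_contra hne
  apply hm
  have h3 := hR (subset_tsupport _ hne)
  rw [mem_closedBall_zero_iff] at h3
  rw [Fintype.mem_piFinset]
  intro i
  have h4 : |θ i - m i| ≤ R := (norm_le_pi_norm (fun i => θ i - m i) i).trans h3
  have h5 : |θ i| ≤ B := (norm_le_pi_norm θ i).trans hθ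
  have h6 := Int.le_ceil (R + B)
  rw [abs_le] at h4 h5
  rw [Finset.mem_Icc]
  constructor
  · have : (-(⌈R + B⌉ : ℝ)) ≤ m i := by linarith
    exact_mod_cast this
  · have : (m i : ℝ) ≤ ⌈R + B⌉ := by linarith
    exact_mod_cast this

theorem periodize_continuous {d : ℕ} {φ : (Fin d → ℝ) → ℂ} (h1 : Continuous φ)
    (h2 : HasCompactSupport φ) :
    Continuous fun θ : Fin d → ℝ => ∑' m : Fin d → ℤ, φ (fun i => θ i - m i) := by
  rw [continuous_iff_continuousAt]
  intro θ₀
  obtain ⟨T, hT⟩ := box_support h2 (‖θ₀‖ + 1)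
  have h3 : ContinuousAt (fun θ : Fin d → ℝ => ∑ m ∈ T, φ (fun i => θ i - m i)) θ₀ := by
    refine Continuous.continuousAt (continuous_finsetSum _ fun m _ => ?_)
    fun_prop
  refine h3.congr ?_
  have h4 : ∀ᶠ θ : Fin d → ℝ in nhds θ₀, ‖θ‖ < ‖θ₀‖ + 1 :=
    continuous_norm.continuousAt.eventually_lt continuousAt_const (by simp)
  filter_upwards [h4] with θ hθ
  rw [tsum_eq_sum (s := T)]
  intro m hm
  exact hT θ hθ.le m hm

theorem mFourier_coe {d : ℕ} (n : Fin d → ℤ) (x : Fin d → ℝ) :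
    UnitAddTorus.mFourier n (fun i => (x i : UnitAddCircle)) =
      Complex.exp ((2 * Real.pi * ∑ i, (n i : ℝ) * x i : ℝ) * Complex.I) := by
  simp only [UnitAddTorus.mFourier, ContinuousMap.coe_mk, fourier_coe_apply]
  rw [← Complex.exp_sum]
  congr 1
  push_cast
  rw [Finset.mul_sum, Finset.sum_mul]
  refine Finset.sum_congr rfl fun i _ => ?_
  simp
  ring

theorem periodize {d : ℕ} {φ : (Fin d → ℝ) → ℂ} (h1 : Continuous φ)
    (h2 : HasCompactSupport φ) :
    ∃ F : C(UnitAddTorus (Fin d), ℂ),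
      (∀ θ : Fin d → ℝ, F (fun i => (θ i : UnitAddCircle)) = ∑' m : Fin d → ℤ, φ (fun i => θ i - m i)) ∧
      ∀ n : Fin d → ℤ, UnitAddTorus.mFourierCoeff F n =
        ∫ x : Fin d → ℝ, Complex.exp ((2 * Real.pi * ∑ i, ((-n) i : ℝ) * x i : ℝ) * Complex.I) * φ x := by
  let P : C(Fin d → ℝ, ℂ) := ⟨_, periodize_continuous h1 h2⟩
  let π : C(Fin d → ℝ, UnitAddTorus (Fin d)) := ⟨fun x i => (x i : UnitAddCircle), by
    refine continuous_pi fun i => ?_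
    exact (AddCircle.continuous_mk' 1).comp (continuous_apply i)⟩
  have hπ : Topology.IsQuotientMap π :=
    (IsOpenQuotientMap.piMap (f := fun (_ : Fin d) (x : ℝ) => (x : UnitAddCircle))
      (fun i => QuotientAddGroup.isOpenQuotientMap_mk)).isQuotientMap
  have hfac : Function.FactorsThrough P π := by
    intro x y hxy
    have : ∀ i, ∃ m : ℤ, x i = y i + m := by
      intro i
      have h3 : (x i : UnitAddCircle) = (y i : UnitAddCircle) := congrFun hxy i
      obtain ⟨m, hm⟩ := AddSubgroup.mem_zmultiples_iff.1 (QuotientAddGroup.eq.1 h3)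
      refine ⟨-m, ?_⟩
      simp at hm
      push_cast
      linarith
    choose m hm using this
    change ∑' l : Fin d → ℤ, φ (fun i => x i - l i) = ∑' l : Fin d → ℤ, φ (fun i => y i - l i)
    rw [← (Equiv.addRight m).tsum_eq (fun l : Fin d → ℤ => φ (fun i => x i - l i))]
    refine tsum_congr fun l => ?_
    congr 1
    funext i
    simp [hm]
  refine ⟨hπ.lift P hfac, ?_, ?_⟩
  · intro θ
    exact congrArg (fun g => g θ) (hπ.lift_comp P hfac)
  intro n
  have hP : ∀ θ : Fin d → ℝ, hπ.lift P hfac (fun i => (θ i : UnitAddCircle)) =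
    ∑' m : Fin d → ℤ, φ (fun i => θ i - m i) := fun θ => congrArg (fun g => g θ) (hπ.lift_comp P hfac)
  rw [UnitAddTorus.mFourierCoeff_eq_integral _ n 0]
  simp_rw [hP, mFourier_coe]
  set Q : Set (Fin d → ℝ) := {x | ∀ i, x i ∈ Set.Ioc ((0 : Fin d → ℝ) i) ((0 : Fin d → ℝ) i + 1)} with hQ
  have hQm : MeasurableSet Q := MeasurableSet.univ_pi' (fun i => measurableSet_Ioc)
  set E : (Fin d → ℝ) → ℂ := fun x => Complex.exp ((2 * Real.pi * ∑ i, ((-n) i : ℝ) * x i : ℝ) * Complex.I) with hE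
  have hEc : Continuous E := by
    rw [hE]; fun_prop
  have hEper : ∀ (x : Fin d → ℝ) (m : Fin d → ℤ), E (fun i => x i - m i) = E x := by
    intro x m
    simp only [hE]
    have h3 := mFourier_coe (-n) (fun i => x i - m i)
    have h4 := mFourier_coe (-n) x
    rw [← h3, ← h4]
    congr 1
    funext i
    refine QuotientAddGroup.eq.2 (AddSubgroup.mem_zmultiples_iff.2 ⟨m i, ?_⟩)
    simp
  have hEeq : ∀ x : Fin d → ℝ, Complex.exp ((2 * Real.pi * ∑ i, ((-n) i : ℝ) * x i : ℝ) * Complex.I) = E x := fun x => rfl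
  obtain ⟨T, hT⟩ := box_support h2 1
  have hQn : ∀ x ∈ Q, ‖x‖ ≤ 1 := by
    intro x hx
    rw [pi_norm_le_iff_of_nonneg zero_le_one]
    intro i
    have := hx i
    simp at this
    rw [Real.norm_eq_abs, abs_le]
    constructor <;> linarith
  have hG : Continuous fun x => E x * φ x := hEc.mul h1
  have hGi : Integrable (fun x => E x * φ x) := hG.integrable_of_hasCompactSupport h2.mul_left
  let S : (Fin d → ℤ) → Set (Fin d → ℝ) := fun m => (fun x : Fin d → ℝ => x + fun i => (m i : ℝ)) ⁻¹' Q
  have hSm : ∀ m, MeasurableSet (S m) := fun m => hQm.preimage (measurable_add_const _)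
  have hSd : Pairwise (Function.onFun Disjoint S) := by
    intro m m' hmm
    refine Set.disjoint_left.2 fun x hx hx' => hmm ?_
    funext i
    have h3 := hx i
    have h4 := hx' i
    simp at h3 h4
    have h5 : (m i : ℝ) < m' i + 1 := by linarith
    have h6 : (m' i : ℝ) < m i + 1 := by linarith
    have h7 : m i < m' i + 1 := by exact_mod_cast h5
    have h8 : m' i < m i + 1 := by exact_mod_cast h6
    omega
  have hSu : (⋃ m, S m) = Set.univ := by
    refine Set.eq_univ_of_forall fun x => Set.mem_iUnion.2 ⟨fun i => 1 - ⌈x i⌉, fun i => ?_⟩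
    have h3 := Int.le_ceil (x i)
    have h4 := Int.ceil_lt_add_one (x i)
    simp
    constructor <;> linarith
  have h5 := hasSum_integral_iUnion (μ := volume) (f := fun x => E x * φ x) hSm hSd hGi.integrableOn
  rw [hSu, setIntegral_univ] at h5
  rw [← h5.tsum_eq]
  have h6 : ∀ m : Fin d → ℤ, ∫ x in S m, E x * φ x = ∫ x in Q, E x * φ (fun i => x i - m i) := by
    intro m
    have h7 := (measurePreserving_add_right volume (fun i => (m i : ℝ))).setIntegral_preimage_emb
      (measurableEmbedding_addRight _) (fun x : Fin d → ℝ => E x * φ (fun i => x i - m i)) Q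
    rw [← h7]
    refine setIntegral_congr_fun (hSm m) fun x _ => ?_
    simp only [Pi.add_apply, add_sub_cancel_right]
    congr 1
    rw [← hEper (x + fun i => (m i : ℝ)) m]
    simp
  simp_rw [h6]
  rw [tsum_eq_sum (s := T), ← integral_finsetSum]
  · refine setIntegral_congr_fun hQm fun x hx => ?_
    simp only [smul_eq_mul]
    rw [tsum_eq_sum (s := T), Finset.mul_sum]
    · intro m hm
      exact hT x (hQn x hx) m hm
  · intro m _
    refine Integrable.integrableOn ?_
    refine Continuous.integrable_of_hasCompactSupport (by fun_prop) ?_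
    refine HasCompactSupport.mul_left ?_
    exact h2.comp_homeomorph (Homeomorph.subRight (fun i => (m i : ℝ)))
  · intro m hm
    rw [setIntegral_congr_fun (g := fun _ => 0) hQm]
    · simp
    · intro x hx
      simp [hT x (hQn x hx) m hm]

end Lac

namespace Lac

/-- A summable weight on `ℤ^d`. -/
noncomputable def wt {d : ℕ} (n : Fin d → ℤ) : ℝ := ∏ i, (1 + (n i : ℝ) ^ 2)⁻¹

theorem wt_pos {d : ℕ} (n : Fin d → ℤ) : 0 < wt n :=
  Finset.prod_pos fun i _ => by positivity

theorem summable_one : Summable fun n : ℤ => (1 + (n : ℝ) ^ 2)⁻¹ := by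
  have h1 : Summable fun n : ℤ => 1 / (n : ℝ) ^ 2 := Real.summable_one_div_int_pow.2 (by norm_num)
  have h2 : Summable fun n : ℤ => if n = 0 then (1 : ℝ) else 0 :=
    summable_of_ne_finset_zero (s := {0}) (by intro b hb; simp at hb; simp [hb])
  refine Summable.of_nonneg_of_le (fun n => by positivity) (fun n => ?_) (h1.add h2)
  by_cases hn : n = 0
  · simp [hn]
  · have : (0 : ℝ) < (n : ℝ) ^ 2 := by positivity
    simp only [hn, if_false, add_zero, one_div]
    gcongr
    linarith

theorem summable_wt (d : ℕ) : Summable fun n : Fin d → ℤ => wt n := by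
  classical
  refine summable_of_sum_le (c := (∑' n : ℤ, (1 + (n : ℝ) ^ 2)⁻¹) ^ d) (fun n => (wt_pos n).le) fun u => ?_
  have h1 : u ⊆ Fintype.piFinset fun i => u.image fun n => n i := by
    intro n hn
    rw [Fintype.mem_piFinset]
    exact fun i => Finset.mem_image_of_mem (fun n : Fin d → ℤ => n i) hn
  refine (Finset.sum_le_sum_of_subset_of_nonneg h1 fun n _ _ => (wt_pos n).le).trans ?_
  unfold wt
  rw [← Finset.prod_univ_sum (fun i => u.image fun n : Fin d → ℤ => n i)
    (fun (_ : Fin d) (n : ℤ) => (1 + (n : ℝ) ^ 2)⁻¹)]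
  refine (Finset.prod_le_prod (g := fun _ => (∑' n : ℤ, (1 + (n : ℝ) ^ 2)⁻¹)) ?_ ?_).trans ?_
  · intro i _
    exact Finset.sum_nonneg fun n _ => by positivity
  · intro i _
    exact summable_one.sum_le_tsum _ fun n _ => by positivity
  · simp

theorem coef_scale {d : ℕ} (f : (Fin d → ℝ) → ℝ) (N : ℕ) (hN : 1 ≤ N) (n : Fin d → ℤ) :
    ∫ x : Fin d → ℝ, Complex.exp ((2 * Real.pi * ∑ i, ((-n) i : ℝ) * x i : ℝ) * Complex.I) *
      (f (fun i => N * x i) : ℂ) = (((N : ℝ) ^ d)⁻¹ : ℝ) * gF f (fun i => n i / N) := by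
  have hN' : (N : ℝ) ≠ 0 := by positivity
  have := Measure.integral_comp_smul (volume : Measure (Fin d → ℝ))
    (fun x => Complex.exp ((-2 * Real.pi * ∑ i, (n i / N : ℝ) * x i : ℝ) * Complex.I) * (f x : ℂ)) (N : ℝ)
  rw [Module.finrank_fintype_fun_eq_card, Fintype.card_fin, abs_of_nonneg (by positivity)] at this
  rw [gF, ← Complex.real_smul, ← this]
  refine integral_congr_ae (Eventually.of_forall fun x => ?_)
  simp only [Pi.smul_apply, smul_eq_mul]
  congr 4
  rw [Finset.mul_sum, Finset.mul_sum]
  refine Finset.sum_congr rfl fun i _ => ?_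
  simp only [Pi.neg_apply]
  push_cast
  field_simp

theorem wt_bound {d : ℕ} (n : Fin d → ℤ) (x : ℝ) (hx1 : 1 ≤ x) (hx : ∀ i, |(n i : ℝ)| ≤ x) :
    1 ≤ 2 ^ d * wt n * x ^ (2 * d) := by
  have h1 : ∏ i, (1 + (n i : ℝ) ^ 2) ≤ ∏ _i : Fin d, (2 * x ^ 2) := by
    refine Finset.prod_le_prod (fun i _ => by positivity) fun i _ => ?_
    have := hx i
    have h2 : (n i : ℝ) ^ 2 ≤ x ^ 2 := by
      rw [← sq_abs]; gcongr
    nlinarith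
  have h3 : wt n * ∏ i, (1 + (n i : ℝ) ^ 2) = 1 := by
    rw [wt, ← Finset.prod_mul_distrib]
    refine Finset.prod_eq_one fun i _ => ?_
    have : (1 + (n i : ℝ) ^ 2) ≠ 0 := by positivity
    field_simp
  rw [Finset.prod_const, Finset.card_univ, Fintype.card_fin, mul_pow, ← pow_mul] at h1
  calc (1 : ℝ) = wt n * ∏ i, (1 + (n i : ℝ) ^ 2) := h3.symm
    _ ≤ wt n * (2 ^ d * x ^ (2 * d)) := by gcongr; exact (wt_pos n).le
    _ = _ := by ring

theorem gF_bound {d : ℕ} (f : (Fin d → ℝ) → ℝ) (hf1 : ContDiff ℝ (⊤ : ℕ∞) f)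
    (hf2 : HasCompactSupport f) (L : ℕ) :
    ∃ C : ℝ, 0 < C ∧ ∀ N : ℕ, 1 ≤ N → ∀ n : Fin d → ℤ, n ≠ 0 → ∀ y : ℝ, 0 ≤ y →
      y ≤ ‖fun i => (n i : ℝ)‖ →
      ‖gF f (fun i => n i / N)‖ * y ^ L ≤ C * wt n * (N : ℝ) ^ (2 * d + L) := by
  obtain ⟨C, hC, h⟩ := gF_decay f hf1 hf2 (2 * d + L)
  refine ⟨2 ^ d * C, by positivity, fun N hN n hn y hy0 hy => ?_⟩
  have hN' : (0 : ℝ) < N := by positivity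
  set x := ‖fun i => (n i : ℝ)‖ with hx
  have hx2 : ∀ i, |(n i : ℝ)| ≤ x := fun i => norm_le_pi_norm (fun i => (n i : ℝ)) i
  have hx1 : 1 ≤ x := by
    obtain ⟨i, hi⟩ := Function.ne_iff.1 hn
    refine le_trans ?_ (hx2 i)
    have : (1 : ℤ) ≤ |n i| := Int.one_le_abs hi
    exact_mod_cast this
  have h1 : ‖fun i => (n i / N : ℝ)‖ = x / N := by
    have : (fun i => (n i / N : ℝ)) = (N : ℝ)⁻¹ • fun i => (n i : ℝ) := by
      funext i; simp; ring
    rw [this, norm_smul, Real.norm_eq_abs, abs_of_pos (by positivity)]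
    ring
  have h2 := h (fun i => n i / N)
  rw [h1, div_pow] at h2
  have h3 : x ^ (2 * d + L) * ‖gF f (fun i => n i / N)‖ ≤ C * (N : ℝ) ^ (2 * d + L) := by
    rw [div_mul_eq_mul_div, div_le_iff₀ (by positivity)] at h2
    exact h2
  have h4 := wt_bound n x hx1 hx2
  have hw := wt_pos n
  calc ‖gF f (fun i => n i / N)‖ * y ^ L ≤ ‖gF f (fun i => n i / N)‖ * x ^ L := by gcongr
    _ ≤ (‖gF f (fun i => n i / N)‖ * x ^ L) * (2 ^ d * wt n * x ^ (2 * d)) :=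
        le_mul_of_one_le_right (by positivity) h4
    _ = 2 ^ d * wt n * (x ^ (2 * d + L) * ‖gF f (fun i => n i / N)‖) := by ring
    _ ≤ 2 ^ d * wt n * (C * (N : ℝ) ^ (2 * d + L)) := by gcongr
    _ = _ := by ring

theorem fourier_approx {d : ℕ} (f : (Fin d → ℝ) → ℝ) (hf1 : ContDiff ℝ (⊤ : ℕ∞) f)
    (hf2 : HasCompactSupport f) (ε : ℝ) (hε : 0 < ε) (A : ℕ) :
    ∃ C : ℝ, 0 < C ∧ ∀ N : ℕ, 1 ≤ N → ∃ coef : (Fin d → ℤ) → ℂ,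
      coef 0 = ((((N : ℝ) ^ d)⁻¹ * ∫ x, f x : ℝ) : ℂ) ∧
      (∀ n, ‖coef n‖ ≤ C * ((N : ℝ) ^ d)⁻¹) ∧
      ∀ θ : Fin d → ℝ, ‖((∑' m : Fin d → ℤ, f (fun i => N * (θ i - m i)) : ℝ) : ℂ) -
        ∑ n ∈ Fintype.piFinset (fun _ : Fin d => Finset.Icc (-(⌈(N : ℝ) ^ (1 + ε)⌉₊ : ℤ)) ⌈(N : ℝ) ^ (1 + ε)⌉₊),
          coef n * Complex.exp ((2 * Real.pi * ∑ i, (n i : ℝ) * θ i : ℝ) * Complex.I)‖ ≤ C * ((N : ℝ) ^ A)⁻¹ := by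
  classical
  obtain ⟨C0, hC0, hb0⟩ := gF_decay f hf1 hf2 0
  obtain ⟨L, hL⟩ := exists_nat_ge ((2 * d + A) / ε)
  obtain ⟨C1, hC1, hb1⟩ := gF_bound f hf1 hf2 L
  set Z := ∑' n : Fin d → ℤ, wt n with hZ
  have hZ0 : 0 ≤ Z := tsum_nonneg fun n => (wt_pos n).le
  refine ⟨C0 + C1 * Z, by positivity, fun N hN => ?_⟩
  have hN1 : (1 : ℝ) ≤ N := by exact_mod_cast hN
  have hN0 : (0 : ℝ) < N := by positivity
  let φ : (Fin d → ℝ) → ℂ := fun x => (f (fun i => N * x i) : ℂ)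
  have hφ1 : Continuous φ := by
    have := hf1.continuous
    fun_prop
  have hφ2 : HasCompactSupport φ := by
    have := hf2.comp_homeomorph (Homeomorph.smulOfNeZero (α := Fin d → ℝ) (N : ℝ) hN0.ne')
    exact this.comp_left (g := fun x : ℝ => (x : ℂ)) (by simp)
  obtain ⟨F, hF, hFc⟩ := periodize hφ1 hφ2
  have hco : ∀ n, UnitAddTorus.mFourierCoeff F n = (((N : ℝ) ^ d)⁻¹ : ℝ) * gF f (fun i => n i / N) :=
    fun n => (hFc n).trans (coef_scale f N hN n)
  have hNd : ((N : ℝ) ^ d)⁻¹ ≤ 1 := inv_le_one_of_one_le₀ (one_le_pow₀ hN1)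
  have hnorm : ∀ n, ‖UnitAddTorus.mFourierCoeff F n‖ = ((N : ℝ) ^ d)⁻¹ * ‖gF f (fun i => n i / N)‖ := by
    intro n
    rw [hco, norm_mul, Complex.norm_real, Real.norm_eq_abs, abs_of_nonneg (by positivity)]
  have hsum : Summable (UnitAddTorus.mFourierCoeff F) := by
    refine Summable.of_norm_bounded (g := fun n => (C0 + C1 * (N : ℝ) ^ (2 * d + L)) * wt n)
      ((summable_wt d).mul_left _) fun n => ?_
    rw [hnorm]
    refine (mul_le_of_le_one_left (norm_nonneg _) hNd).trans ?_
    have hw := wt_pos n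
    by_cases hn : n = 0
    · have h1 := hb0 (fun i => n i / N)
      rw [pow_zero, one_mul] at h1
      have h2 : wt n = 1 := by simp [wt, hn]
      rw [h2]
      have : 0 ≤ C1 * (N : ℝ) ^ (2 * d + L) := by positivity
      linarith
    · have hx1 : 1 ≤ ‖fun i => (n i : ℝ)‖ := by
        obtain ⟨i, hi⟩ := Function.ne_iff.1 hn
        refine le_trans ?_ (norm_le_pi_norm (fun i => (n i : ℝ)) i)
        have : (1 : ℤ) ≤ |n i| := Int.one_le_abs hi
        rw [Real.norm_eq_abs]
        exact_mod_cast this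
      have h1 := hb1 N hN n hn 1 zero_le_one hx1
      rw [one_pow, mul_one] at h1
      have : 0 ≤ C0 * wt n := by positivity
      linarith
  refine ⟨UnitAddTorus.mFourierCoeff F, ?_, ?_, ?_⟩
  · rw [hco]
    push_cast
    congr 1
    simp [gF, integral_complex_ofReal]
  · intro n
    rw [hnorm, mul_comm]
    have h1 := hb0 (fun i => n i / N)
    rw [pow_zero, one_mul] at h1
    have : 0 ≤ C1 * Z := by positivity
    gcongr
    linarith
  · intro θ
    have h1 := UnitAddTorus.hasSum_mFourier_series_apply_of_summable hsum (fun i => (θ i : UnitAddCircle))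
    rw [hF] at h1
    simp only [mFourier_coe, smul_eq_mul] at h1
    rw [Complex.ofReal_tsum]
    set B := Fintype.piFinset (fun _ : Fin d => Finset.Icc (-(⌈(N : ℝ) ^ (1 + ε)⌉₊ : ℤ)) ⌈(N : ℝ) ^ (1 + ε)⌉₊) with hB
    set t : (Fin d → ℤ) → ℂ := fun n => UnitAddTorus.mFourierCoeff F n *
      Complex.exp ((2 * Real.pi * ∑ i, (n i : ℝ) * θ i : ℝ) * Complex.I) with ht
    have h2 : HasSum (fun n => if n ∈ B then t n else 0) (∑ n ∈ B, t n) := by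
      have := hasSum_sum_of_ne_finset_zero (f := fun n => if n ∈ B then t n else 0) (s := B)
        (L := SummationFilter.unconditional _)
        (by intro n hn; simp [hn])
      rwa [Finset.sum_congr rfl (g := t) (fun n hn => by simp [hn])] at this
    have h3 := h1.sub h2
    have h4 : HasSum (fun n : Fin d → ℤ => C1 * ((N : ℝ) ^ A)⁻¹ * wt n) (C1 * ((N : ℝ) ^ A)⁻¹ * Z) :=
      (summable_wt d).hasSum.mul_left _
    have h5 : ‖(∑' m : Fin d → ℤ, φ (fun i => θ i - m i)) - ∑ n ∈ B, t n‖ ≤ C1 * ((N : ℝ) ^ A)⁻¹ * Z := by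
      rw [← h3.tsum_eq]
      refine tsum_of_norm_bounded h4 fun n => ?_
      have hw := wt_pos n
      by_cases hn : n ∈ B
      · simp only [hn, if_true]
        rw [sub_self, norm_zero]
        positivity
      · simp only [hn, if_false, sub_zero]
        rw [norm_mul, Complex.norm_exp_ofReal_mul_I, mul_one, hnorm]
        refine (mul_le_of_le_one_left (norm_nonneg _) hNd).trans ?_
        have hy : (N : ℝ) ^ (1 + ε) ≤ ‖fun i => (n i : ℝ)‖ := by
          rw [hB, Fintype.mem_piFinset] at hn
          push Not at hn
          obtain ⟨i, hi⟩ := hn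
          refine le_trans ?_ (norm_le_pi_norm (fun i => (n i : ℝ)) i)
          refine (Nat.le_ceil _).trans ?_
          rw [Real.norm_eq_abs]
          rw [Finset.mem_Icc, ← abs_le] at hi
          push Not at hi
          exact_mod_cast hi.le
        have hn0 : n ≠ 0 := by
          rintro rfl
          apply hn
          rw [hB, Fintype.mem_piFinset]
          intro i
          simp
        have h6 := hb1 N hN n hn0 _ (by positivity) hy
        have h7 : (N : ℝ) ^ (2 * d + L) * (N : ℝ) ^ A ≤ ((N : ℝ) ^ (1 + ε)) ^ L := by
          rw [← Real.rpow_natCast, ← Real.rpow_natCast, ← Real.rpow_natCast, ← Real.rpow_add hN0,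
            ← Real.rpow_mul hN0.le]
          refine Real.rpow_le_rpow_of_exponent_le hN1 ?_
          rw [div_le_iff₀ hε] at hL
          push_cast
          nlinarith
        have hA : (0 : ℝ) < (N : ℝ) ^ A := by positivity
        have h8 : (‖gF f (fun i => n i / N)‖ * (N : ℝ) ^ A) * (N : ℝ) ^ (2 * d + L) ≤ (C1 * wt n) * (N : ℝ) ^ (2 * d + L) := by
          calc _ = ‖gF f (fun i => n i / N)‖ * ((N : ℝ) ^ (2 * d + L) * (N : ℝ) ^ A) := by ring
            _ ≤ ‖gF f (fun i => n i / N)‖ * ((N : ℝ) ^ (1 + ε)) ^ L := by gcongr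
            _ ≤ _ := h6
        have h9 := le_of_mul_le_mul_right h8 (by positivity)
        rw [← le_div_iff₀ hA] at h9
        refine h9.trans (le_of_eq ?_)
        field_simp
    refine h5.trans ?_
    have : 0 ≤ C0 * ((N : ℝ) ^ A)⁻¹ := by positivity
    nlinarith

end Lac

namespace Lac

theorem gauss_int (ω : ℝ) :
    Integrable (fun α : ℝ => Complex.exp ((2 * Real.pi * (α * ω) : ℝ) * Complex.I) *
      (Real.exp (-Real.pi * α ^ 2) : ℂ)) ∧
    ∫ α : ℝ, Complex.exp ((2 * Real.pi * (α * ω) : ℝ) * Complex.I) *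
      (Real.exp (-Real.pi * α ^ 2) : ℂ) = (Real.exp (-Real.pi * ω ^ 2) : ℂ) := by
  have hπ := Real.pi_pos
  have h0 : Integrable (fun α : ℝ => Real.exp (-Real.pi * α ^ 2)) := integrable_exp_neg_mul_sq hπ
  constructor
  · refine Integrable.bdd_mul (c := 1) h0.ofReal ?_ ?_
    · exact Continuous.aestronglyMeasurable (by fun_prop)
    · exact Eventually.of_forall fun α => by rw [Complex.norm_exp_ofReal_mul_I]
  · have h1 := fourier_gaussian_pi (b := 1) (by simp)
    have h2 := congrFun h1 (-ω)
    rw [Real.fourier_eq'] at h2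
    simp only [smul_eq_mul] at h2
    convert h2 using 1
    · congr 1
      funext α
      congr 1
      · congr 2
        simp
        ring
      · push_cast
        congr 1
        ring
    · push_cast
      simp

theorem l2_bound {ι : Type*} (I : Finset ι) (c : ι → ℂ) (ω : ι → ℝ) (M : ℝ) (hc : ∀ p ∈ I, ‖c p‖ ≤ M) :
    Integrable (fun α : ℝ => ‖∑ p ∈ I, c p * Complex.exp ((2 * Real.pi * (α * ω p) : ℝ) * Complex.I)‖ ^ 2 *
      Real.exp (-Real.pi * α ^ 2)) ∧
    ∫ α : ℝ, ‖∑ p ∈ I, c p * Complex.exp ((2 * Real.pi * (α * ω p) : ℝ) * Complex.I)‖ ^ 2 *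
      Real.exp (-Real.pi * α ^ 2) ≤ M ^ 2 * ∑ p ∈ I, ∑ q ∈ I, Real.exp (-Real.pi * (ω p - ω q) ^ 2) := by
  have key : ∀ α : ℝ, ((‖∑ p ∈ I, c p * Complex.exp ((2 * Real.pi * (α * ω p) : ℝ) * Complex.I)‖ ^ 2 *
      Real.exp (-Real.pi * α ^ 2) : ℝ) : ℂ) = ∑ p ∈ I, ∑ q ∈ I, (c p * (starRingEnd ℂ) (c q)) *
        (Complex.exp ((2 * Real.pi * (α * (ω p - ω q)) : ℝ) * Complex.I) * (Real.exp (-Real.pi * α ^ 2) : ℂ)) := by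
    intro α
    rw [Complex.ofReal_mul, Complex.ofReal_pow, ← Complex.mul_conj', map_sum, Finset.sum_mul_sum,
      Finset.sum_mul]
    refine Finset.sum_congr rfl fun p _ => ?_
    rw [Finset.sum_mul]
    refine Finset.sum_congr rfl fun q _ => ?_
    rw [map_mul, ← Complex.exp_conj, map_mul, Complex.conj_I, Complex.conj_ofReal]
    have : Complex.exp ((2 * Real.pi * (α * (ω p - ω q)) : ℝ) * Complex.I) =
      Complex.exp ((2 * Real.pi * (α * ω p) : ℝ) * Complex.I) * Complex.exp ((2 * Real.pi * (α * ω q) : ℝ) * -Complex.I) := by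
      rw [← Complex.exp_add]
      congr 1
      push_cast
      ring
    rw [this]
    ring
  have hIpq : ∀ p q, Integrable (fun α : ℝ => (c p * (starRingEnd ℂ) (c q)) *
        (Complex.exp ((2 * Real.pi * (α * (ω p - ω q)) : ℝ) * Complex.I) * (Real.exp (-Real.pi * α ^ 2) : ℂ))) :=
    fun p q => (gauss_int _).1.const_mul _
  have hI : Integrable (fun α : ℝ => ((‖∑ p ∈ I, c p * Complex.exp ((2 * Real.pi * (α * ω p) : ℝ) * Complex.I)‖ ^ 2 *
      Real.exp (-Real.pi * α ^ 2) : ℝ) : ℂ)) := by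
    simp_rw [key]
    exact integrable_finsetSum _ fun p _ => integrable_finsetSum _ fun q _ => hIpq p q
  refine ⟨hI.re, ?_⟩
  have h1 := congrArg norm (integral_ofReal (𝕜 := ℂ) (μ := volume)
    (f := fun α : ℝ => ‖∑ p ∈ I, c p * Complex.exp ((2 * Real.pi * (α * ω p) : ℝ) * Complex.I)‖ ^ 2 *
      Real.exp (-Real.pi * α ^ 2)))
  have h2 : ∫ α : ℝ, ((‖∑ p ∈ I, c p * Complex.exp ((2 * Real.pi * (α * ω p) : ℝ) * Complex.I)‖ ^ 2 *
      Real.exp (-Real.pi * α ^ 2) : ℝ) : ℂ) = ∑ p ∈ I, ∑ q ∈ I, (c p * (starRingEnd ℂ) (c q)) *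
        (Real.exp (-Real.pi * (ω p - ω q) ^ 2) : ℂ) := by
    simp_rw [key]
    rw [integral_finsetSum _ fun p _ => integrable_finsetSum _ fun q _ => hIpq p q]
    refine Finset.sum_congr rfl fun p _ => ?_
    rw [integral_finsetSum _ fun q _ => hIpq p q]
    refine Finset.sum_congr rfl fun q _ => ?_
    rw [integral_const_mul, (gauss_int _).2]
  have h3 : ∀ x : ℝ, x ≤ ‖(x : ℂ)‖ := fun x => by
    rw [Complex.norm_real]; exact le_abs_self x
  refine (h3 _).trans ?_
  refine (le_of_eq h1.symm).trans ?_
  refine (le_of_eq (congrArg norm h2)).trans ?_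
  rw [Finset.mul_sum]
  refine norm_sum_le_of_le _ fun p hp => ?_
  rw [Finset.mul_sum]
  refine norm_sum_le_of_le _ fun q hq => ?_
  rw [norm_mul, norm_mul, RCLike.norm_conj, Complex.norm_real, Real.norm_eq_abs, Real.abs_exp, pow_two M]
  have hM : 0 ≤ M := (norm_nonneg _).trans (hc p hp)
  gcongr
  · exact hc p hp
  · exact hc q hq

theorem card_inj (k N : ℕ) : (((Fintype.piFinset fun _ : Fin k => Finset.Icc 1 N).filter
        (fun x => Function.Injective x)).card) = N.descFactorial k := by
  classical
  have h1 := Fintype.card_embedding_eq (α := Fin k) (β := Finset.Icc 1 N)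
  rw [Fintype.card_coe, Nat.card_Icc, Nat.add_sub_cancel, Fintype.card_fin] at h1
  rw [← h1, ← Finset.card_univ]
  symm
  refine Finset.card_bij (fun e _ => fun i => ((e i : Finset.Icc 1 N) : ℕ)) ?_ ?_ ?_
  · intro e _
    rw [Finset.mem_filter, Fintype.mem_piFinset]
    exact ⟨fun i => (e i).2, Subtype.val_injective.comp e.injective⟩
  · intro e _ e' _ h
    ext i
    exact congrFun h i
  · intro x hx
    rw [Finset.mem_filter, Fintype.mem_piFinset] at hx
    exact ⟨⟨fun i => ⟨x i, hx.1 i⟩, fun i j hij => hx.2 (congrArg Subtype.val hij)⟩, Finset.mem_univ _, rfl⟩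

theorem desc_eq (N : ℕ) (hN : 1 ≤ N) (d : ℕ) : (N.descFactorial (d + 1) : ℝ) =
    (N : ℝ) ^ (d + 1) * ∏ j ∈ Finset.Icc 1 d, (1 - (j : ℝ) / (N : ℝ)) := by
  have hN0 : (N : ℝ) ≠ 0 := by positivity
  induction d with
  | zero => simp
  | succ d ih =>
    rw [Nat.descFactorial_succ, Nat.cast_mul, ih, Finset.prod_Icc_succ_top (by omega)]
    by_cases h : d + 1 ≤ N
    · rw [Nat.cast_sub h]
      field_simp
      ring
    · have h1 : N.descFactorial (d + 1) = 0 := Nat.descFactorial_eq_zero_iff_lt.2 (by omega)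
      rw [h1] at ih
      rw [show (N : ℝ) ^ (d + 1 + 1) * ((∏ j ∈ Finset.Icc 1 d, (1 - (j : ℝ) / (N : ℝ))) * (1 - ((d + 1 : ℕ) : ℝ) / N)) =
        N * (1 - ((d + 1 : ℕ) : ℝ) / N) * ((N : ℝ) ^ (d + 1) * ∏ j ∈ Finset.Icc 1 d, (1 - (j : ℝ) / (N : ℝ))) by ring,
        ← ih]
      simp

/-- Summation by parts: frequencies attached to consecutive differences. -/
def Uf {d : ℕ} (n : Fin d → ℤ) : Fin (d + 1) → ℤ :=
  fun j => (Fin.snoc n 0 : Fin (d + 1) → ℤ) j - (Fin.cons 0 n : Fin (d + 1) → ℤ) j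

theorem Uf_sum {d : ℕ} (n : Fin d → ℤ) (b : Fin (d + 1) → ℝ) :
    ∑ j, (Uf n j : ℝ) * b j = ∑ i, (n i : ℝ) * (b i.castSucc - b i.succ) := by
  simp only [Uf, Int.cast_sub, sub_mul, mul_sub, Finset.sum_sub_distrib]
  rw [Fin.sum_univ_castSucc, Fin.sum_univ_succ (fun j => (((Fin.cons 0 n : Fin (d + 1) → ℤ) j : ℤ) : ℝ) * b j)]
  simp

theorem Uf_inj {d : ℕ} : Function.Injective (Uf (d := d)) := by
  intro n n' h
  have key : ∀ (n : Fin d → ℤ) (i₀ : Fin d),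
      ∑ j, (Uf n j : ℝ) * (if j ≤ i₀.castSucc then 1 else 0) = n i₀ := by
    intro n i₀
    rw [Uf_sum, Finset.sum_eq_single i₀]
    · simp
    · intro i _ hi
      rcases lt_or_gt_of_ne hi with h1 | h1
      · rw [if_pos (by simpa using h1.le), if_pos (by rw [Fin.le_def]; simp; exact h1)]
        simp
      · rw [if_neg (by simpa using h1), if_neg (by rw [Fin.le_def]; simp; omega)]
        simp
    · simp
  funext i
  have h1 := key n i
  rw [h, key n' i] at h1
  exact_mod_cast h1.symm

theorem Uf_zero_sum {d : ℕ} (n : Fin d → ℤ) : ∑ j, Uf n j = 0 := by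
  have := Uf_sum n (fun _ => 1)
  simp at this
  exact_mod_cast this

theorem Uf_neg {d : ℕ} (n : Fin d → ℤ) (j) : Uf (-n) j = -Uf n j := by
  have h := Uf_sum (-n) (Pi.single j 1)
  have h' := Uf_sum n (Pi.single j 1)
  simp only [Pi.neg_apply, Int.cast_neg, neg_mul, Finset.sum_neg_distrib] at h
  rw [← h'] at h
  simp [Pi.single_apply] at h
  exact_mod_cast h

theorem Uf_bound {d : ℕ} (n : Fin d → ℤ) (W : ℕ) (hn : ∀ i, -(W : ℤ) ≤ n i ∧ n i ≤ W) (j) :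
    -((2 * W : ℕ) : ℤ) ≤ Uf n j ∧ Uf n j ≤ (2 * W : ℕ) := by
  have h1 : -(W : ℤ) ≤ (Fin.snoc n 0 : Fin (d + 1) → ℤ) j ∧ (Fin.snoc n 0 : Fin (d + 1) → ℤ) j ≤ W := by
    refine Fin.lastCases ?_ (fun i => ?_) j
    · simp
    · simpa using hn i
  have h2 : -(W : ℤ) ≤ (Fin.cons 0 n : Fin (d + 1) → ℤ) j ∧ (Fin.cons 0 n : Fin (d + 1) → ℤ) j ≤ W := by
    refine Fin.cases ?_ (fun i => ?_) j
    · simp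
    · simpa using hn i
  unfold Uf
  push_cast
  constructor <;> linarith [h1.1, h1.2, h2.1, h2.2]

end Lac

namespace Lac

/-- The set of injective tuples. -/
def XX (k N : ℕ) : Finset (Fin k → ℕ) :=
  (Fintype.piFinset fun _ : Fin k => Finset.Icc 1 N).filter (fun x => Function.Injective x)

/-- The nonzero frequencies in the box. -/
noncomputable def BB (d W : ℕ) : Finset (Fin d → ℤ) :=
  (Fintype.piFinset fun _ : Fin d => Finset.Icc (-(W : ℤ)) W).erase 0

/-- The real frequency. -/
noncomputable def om {d : ℕ} (a : ℕ → ℝ) (p : (Fin (d + 1) → ℕ) × (Fin d → ℤ)) : ℝ :=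
  ∑ i, (p.2 i : ℝ) * (a (p.1 i.castSucc) - a (p.1 i.succ))

theorem card_XX_le (k N : ℕ) : (XX k N).card ≤ N ^ k := by
  refine (Finset.card_filter_le _ _).trans ?_
  rw [Fintype.card_piFinset]
  simp

theorem card_BB_le (d W : ℕ) : (BB d W).card ≤ (2 * W + 1) ^ d := by
  refine (Finset.card_erase_le).trans ?_
  rw [Fintype.card_piFinset]
  simp only [Int.card_Icc, Finset.prod_const, Finset.card_univ, Fintype.card_fin]
  apply le_of_eq
  congr 1
  omega

theorem gauss_sum_bound {c : ℝ} {a : ℕ → ℝ} (h : Lacu c a) (d : ℕ) (ε : ℝ) (hε : 0 < ε) (hε1 : ε ≤ 1) :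
    ∃ K : ℝ, 0 < K ∧ ∀ N : ℕ, 1 ≤ N →
      ∑ p ∈ XX (d + 1) N ×ˢ BB d ⌈(N : ℝ) ^ (1 + ε)⌉₊, ∑ q ∈ XX (d + 1) N ×ˢ BB d ⌈(N : ℝ) ^ (1 + ε)⌉₊,
        Real.exp (-Real.pi * (om a p - om a q) ^ 2) ≤
      K * (N : ℝ) ^ (2 * ((d + 1 : ℕ) : ℝ) - 1 + 4 * ((d + 1 : ℕ) : ℝ) * ε) := by
  classical
  obtain ⟨K, hK, hcount⟩ := count_asymp h (d + 1) (by omega) ε hε hε1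
  obtain ⟨r, hr⟩ := exists_nat_ge (3 * (d + 1) / ε)
  refine ⟨K + 9 ^ d * r.factorial, by positivity, fun N hN => ?_⟩
  have hN1 : (1 : ℝ) ≤ N := by exact_mod_cast hN
  have hN0 : (0 : ℝ) < N := by positivity
  set W := ⌈(N : ℝ) ^ (1 + ε)⌉₊ with hW
  set I := XX (d + 1) N ×ˢ BB d W with hI
  rw [← Finset.sum_product' I I (fun p q => Real.exp (-Real.pi * (om a p - om a q) ^ 2))]
  set G := (I ×ˢ I).filter (fun s => |om a s.1 - om a s.2| ≤ (N : ℝ) ^ ε) with hG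
  have hnear : (G.card : ℝ) ≤ K * (N : ℝ) ^ (2 * ((d + 1 : ℕ) : ℝ) - 1 + 4 * ((d + 1 : ℕ) : ℝ) * ε) := by
    let Φ : ((Fin (d + 1) → ℕ) × (Fin d → ℤ)) × ((Fin (d + 1) → ℕ) × (Fin d → ℤ)) →
      (Fin (d + 1) → ℕ) × (Fin (d + 1) → ℤ) × (Fin (d + 1) → ℕ) × (Fin (d + 1) → ℤ) :=
      fun s => (s.1.1, Uf s.1.2, s.2.1, Uf (-s.2.2))
    have hΦ : Function.Injective Φ := by
      rintro ⟨⟨x, n⟩, ⟨x', n'⟩⟩ ⟨⟨y, m⟩, ⟨y', m'⟩⟩ hh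
      simp only [Φ, Prod.mk.injEq] at hh
      obtain ⟨h1, h2, h3, h4⟩ := hh
      have h5 := Uf_inj h2
      have h6 := neg_injective (Uf_inj h4)
      subst h1 h3 h5 h6
      rfl
    rw [← Finset.card_image_of_injective G hΦ]
    refine hcount N (2 * W) hN rfl _ ?_
    intro s hs
    obtain ⟨⟨⟨x, n⟩, ⟨x', n'⟩⟩, ht, rfl⟩ := Finset.mem_image.1 hs
    simp only [hG, hI, Finset.mem_filter, Finset.mem_product, XX, BB, Finset.mem_erase,
      Fintype.mem_piFinset, Finset.mem_Icc] at ht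
    obtain ⟨⟨⟨⟨hx1, hx2⟩, hn0, hn⟩, ⟨⟨hx1', hx2'⟩, hn0', hn'⟩⟩, hω⟩ := ht
    simp only [Φ]
    refine ⟨hx1, hx1', hx2, hx2', Uf_bound n W hn, Uf_bound (-n') W ?_, Uf_zero_sum _, Uf_zero_sum _, ?_, ?_⟩
    · intro i
      have := hn' i
      simp only [Pi.neg_apply]
      constructor <;> linarith [this.1, this.2]
    · intro h0
      apply hn0
      apply Uf_inj
      rw [h0]
      funext j
      have := Uf_neg (0 : Fin d → ℤ) j
      simp at this
      simp
      omega
    · rw [Uf_sum n (fun j => a (x j)), Uf_sum (-n') (fun j => a (x' j))]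
      simp only [om] at hω
      simpa [sub_eq_add_neg] using hω
  have hcardI : (I.card : ℝ) ≤ 3 ^ d * (N : ℝ) ^ (3 * (d + 1)) := by
    have hWN : W ≤ N ^ 2 := by
      rw [hW, Nat.ceil_le]
      push_cast
      rw [← Real.rpow_natCast (N : ℝ) 2]
      refine Real.rpow_le_rpow_of_exponent_le hN1 ?_
      push_cast
      linarith
    have h1 : I.card ≤ N ^ (d + 1) * (3 * N ^ 2) ^ d := by
      rw [hI, Finset.card_product]
      refine Nat.mul_le_mul (card_XX_le _ _) ((card_BB_le _ _).trans ?_)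
      refine Nat.pow_le_pow_left ?_ d
      have : 1 ≤ N ^ 2 := Nat.one_le_pow _ _ hN
      omega
    have h2 : N ^ (d + 1) * (3 * N ^ 2) ^ d ≤ 3 ^ d * N ^ (3 * (d + 1)) := by
      rw [mul_pow, ← pow_mul, mul_left_comm, ← pow_add]
      refine Nat.mul_le_mul_left _ (Nat.pow_le_pow_right hN (by omega))
    exact_mod_cast h1.trans h2
  have hfar : (I.card : ℝ) ^ 2 * Real.exp (-Real.pi * ((N : ℝ) ^ ε) ^ 2) ≤ 9 ^ d * r.factorial := by
    have hy : (0 : ℝ) ≤ Real.pi * ((N : ℝ) ^ ε) ^ 2 := by positivity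
    have h1 := Real.pow_div_factorial_le_exp _ hy r
    have h2 : (N : ℝ) ^ (6 * (d + 1)) ≤ (Real.pi * ((N : ℝ) ^ ε) ^ 2) ^ r := by
      have h3 : (N : ℝ) ^ (6 * (d + 1)) ≤ (((N : ℝ) ^ ε) ^ 2) ^ r := by
        rw [← pow_mul, ← Real.rpow_natCast, ← Real.rpow_natCast, ← Real.rpow_mul hN0.le]
        refine Real.rpow_le_rpow_of_exponent_le hN1 ?_
        rw [div_le_iff₀ hε] at hr
        push_cast
        nlinarith
      refine h3.trans ?_
      gcongr
      refine le_mul_of_one_le_left (by positivity) ?_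
      linarith [Real.pi_gt_three]
    have h4 : (N : ℝ) ^ (6 * (d + 1)) ≤ r.factorial * Real.exp (Real.pi * ((N : ℝ) ^ ε) ^ 2) := by
      refine h2.trans ?_
      rwa [div_le_iff₀' (by positivity)] at h1
    rw [neg_mul, Real.exp_neg, ← div_eq_mul_inv, div_le_iff₀ (Real.exp_pos _)]
    calc (I.card : ℝ) ^ 2 ≤ (3 ^ d * (N : ℝ) ^ (3 * (d + 1))) ^ 2 := by gcongr
      _ = 9 ^ d * (N : ℝ) ^ (6 * (d + 1)) := by
        rw [mul_pow, ← pow_mul, ← pow_mul, mul_comm d 2, pow_mul]; norm_num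
        congr 1; ring
      _ ≤ 9 ^ d * (r.factorial * Real.exp (Real.pi * ((N : ℝ) ^ ε) ^ 2)) := by gcongr
      _ = _ := by ring
  rw [← Finset.sum_filter_add_sum_filter_not (I ×ˢ I) (fun s => |om a s.1 - om a s.2| ≤ (N : ℝ) ^ ε)]
  have h1 : ∑ s ∈ (I ×ˢ I).filter (fun s => |om a s.1 - om a s.2| ≤ (N : ℝ) ^ ε),
      Real.exp (-Real.pi * (om a s.1 - om a s.2) ^ 2) ≤ G.card := by
    rw [← hG, Finset.card_eq_sum_ones]
    push_cast
    refine Finset.sum_le_sum fun s _ => ?_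
    rw [Real.exp_le_one_iff]
    have : 0 ≤ Real.pi * (om a s.1 - om a s.2) ^ 2 := by positivity
    linarith
  have h2 : ∑ s ∈ (I ×ˢ I).filter (fun s => ¬ |om a s.1 - om a s.2| ≤ (N : ℝ) ^ ε),
      Real.exp (-Real.pi * (om a s.1 - om a s.2) ^ 2) ≤ 9 ^ d * r.factorial := by
    refine le_trans ?_ hfar
    refine (Finset.sum_le_card_nsmul _ _ (Real.exp (-Real.pi * ((N : ℝ) ^ ε) ^ 2)) ?_).trans ?_
    · intro s hs
      have h3 := (Finset.mem_filter.1 hs).2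
      push Not at h3
      have h4 : ((N : ℝ) ^ ε) ^ 2 ≤ (om a s.1 - om a s.2) ^ 2 := by
        rw [← sq_abs (om a s.1 - om a s.2)]
        gcongr
      rw [Real.exp_le_exp]
      nlinarith [Real.pi_pos]
    · rw [nsmul_eq_mul]
      gcongr
      have := Finset.card_filter_le (I ×ˢ I) (fun s => ¬ |om a s.1 - om a s.2| ≤ (N : ℝ) ^ ε)
      rw [Finset.card_product, ← sq] at this
      exact_mod_cast this
  have h3 : (1 : ℝ) ≤ (N : ℝ) ^ (2 * ((d + 1 : ℕ) : ℝ) - 1 + 4 * ((d + 1 : ℕ) : ℝ) * ε) := by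
    refine Real.one_le_rpow hN1 ?_
    have : 0 ≤ 4 * ((d + 1 : ℕ) : ℝ) * ε := by positivity
    have h5 : (0 : ℝ) ≤ d := by positivity
    push_cast at *
    linarith
  have h4 : (9 : ℝ) ^ d * r.factorial ≤ 9 ^ d * r.factorial * (N : ℝ) ^ (2 * ((d + 1 : ℕ) : ℝ) - 1 + 4 * ((d + 1 : ℕ) : ℝ) * ε) :=
    le_mul_of_one_le_right (by positivity) h3
  rw [add_mul]
  linarith

end Lac

namespace Lac

theorem corrSum_swap (d N : ℕ) (hN : 1 ≤ N) (b : ℕ → ℝ) (f : (Fin d → ℝ) → ℝ) (hf2 : HasCompactSupport f) :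
    corrSum (d + 1) N b f = (1 / (N : ℝ)) * ∑ x ∈ XX (d + 1) N, ∑' m : Fin d → ℤ,
      f (fun i => (N : ℝ) * ((b (x i.castSucc) - b (x i.succ)) - m i)) := by
  have hN0 : (N : ℝ) ≠ 0 := by positivity
  let φ : (Fin d → ℝ) → ℂ := fun x => (f (fun i => N * x i) : ℂ)
  have hφ2 : HasCompactSupport φ := by
    have := hf2.comp_homeomorph (Homeomorph.smulOfNeZero (α := Fin d → ℝ) (N : ℝ) hN0)
    exact this.comp_left (g := fun x : ℝ => (x : ℂ)) (by simp)
  rw [← Summable.tsum_finsetSum]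
  · rfl
  · intro x _
    obtain ⟨T, hT⟩ := box_support hφ2 ‖fun i : Fin d => b (x i.castSucc) - b (x i.succ)‖
    refine summable_of_ne_finset_zero (s := T) fun m hm => ?_
    have := hT _ le_rfl m hm
    simp only [φ] at this
    exact_mod_cast this

theorem pointwise (d N : ℕ) (hN : 1 ≤ N) (a : ℕ → ℝ) (f : (Fin d → ℝ) → ℝ) (hf2 : HasCompactSupport f)
    (W : ℕ) (C : ℝ) (coef : (Fin d → ℤ) → ℂ)
    (h0 : coef 0 = ((((N : ℝ) ^ d)⁻¹ * ∫ x, f x : ℝ) : ℂ))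
    (h1 : ∀ θ : Fin d → ℝ, ‖((∑' m : Fin d → ℤ, f (fun i => N * (θ i - m i)) : ℝ) : ℂ) -
        ∑ n ∈ Fintype.piFinset (fun _ : Fin d => Finset.Icc (-(W : ℤ)) W),
          coef n * Complex.exp ((2 * Real.pi * ∑ i, (n i : ℝ) * θ i : ℝ) * Complex.I)‖ ≤ C * ((N : ℝ) ^ (d + 1))⁻¹)
    (α : ℝ) :
    |corrSum (d + 1) N (fun n => α * a n) f - Ck (d + 1) N * ∫ x, f x| ≤
      ‖∑ p ∈ XX (d + 1) N ×ˢ BB d W, (((N : ℝ)⁻¹ : ℝ) * coef p.2) *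
        Complex.exp ((2 * Real.pi * (α * om a p) : ℝ) * Complex.I)‖ + C * (N : ℝ)⁻¹ := by
  have hN0 : (N : ℝ) ≠ 0 := by positivity
  have hNc : (N : ℂ) ≠ 0 := by exact_mod_cast hN0
  set P := ∑ p ∈ XX (d + 1) N ×ˢ BB d W, (((N : ℝ)⁻¹ : ℝ) * coef p.2) *
        Complex.exp ((2 * Real.pi * (α * om a p) : ℝ) * Complex.I) with hP
  have hCk : Ck (d + 1) N * ∫ x, f x = (1 / (N : ℝ)) * ∑ x ∈ XX (d + 1) N, (((N : ℝ) ^ d)⁻¹ * ∫ x, f x) := by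
    have h2 : ((XX (d + 1) N).card : ℝ) = (N : ℝ) ^ (d + 1) * Ck (d + 1) N := by
      rw [XX, card_inj, desc_eq N hN d]
      rfl
    rw [Finset.sum_const, nsmul_eq_mul, h2, pow_succ]
    field_simp
  have hdiff : ((corrSum (d + 1) N (fun n => α * a n) f - Ck (d + 1) N * ∫ x, f x : ℝ) : ℂ) - P =
      ((1 / (N : ℝ) : ℝ) : ℂ) * ∑ x ∈ XX (d + 1) N,
        (((∑' m : Fin d → ℤ, f (fun i => N * ((α * a (x i.castSucc) - α * a (x i.succ)) - m i)) : ℝ) : ℂ) -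
        ∑ n ∈ Fintype.piFinset (fun _ : Fin d => Finset.Icc (-(W : ℤ)) W),
          coef n * Complex.exp ((2 * Real.pi * ∑ i, (n i : ℝ) * (α * a (x i.castSucc) - α * a (x i.succ)) : ℝ) * Complex.I)) := by
    rw [corrSum_swap d N hN _ f hf2, hCk, hP, Finset.sum_product, Complex.ofReal_sub, Complex.ofReal_mul,
      Complex.ofReal_mul, Complex.ofReal_sum, Complex.ofReal_sum, ← mul_sub, ← Finset.sum_sub_distrib, Finset.mul_sum,
      ← Finset.sum_sub_distrib, Finset.mul_sum]
    refine Finset.sum_congr rfl fun x _ => ?_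
    rw [← Finset.add_sum_erase _ _ (show (0 : Fin d → ℤ) ∈ Fintype.piFinset (fun _ : Fin d => Finset.Icc (-(W : ℤ)) W) by
      rw [Fintype.mem_piFinset]; intro i; simp), h0]
    have h3 : ∑ n ∈ BB d W, ((((N : ℝ)⁻¹ : ℝ) : ℂ) * coef (x, n).2) *
        Complex.exp ((2 * Real.pi * (α * om a (x, n)) : ℝ) * Complex.I) =
        ((1 / (N : ℝ) : ℝ) : ℂ) * ∑ n ∈ BB d W, coef n * Complex.exp ((2 * Real.pi * ∑ i, (n i : ℝ) * (α * a (x i.castSucc) - α * a (x i.succ)) : ℝ) * Complex.I) := by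
      rw [Finset.mul_sum]
      refine Finset.sum_congr rfl fun n _ => ?_
      rw [mul_assoc, one_div]
      congr 5
      rw [om, Finset.mul_sum]
      congr 1
      refine Finset.sum_congr rfl fun i _ => ?_
      ring
    rw [h3, BB]
    simp
    ring
  have hE : ‖((corrSum (d + 1) N (fun n => α * a n) f - Ck (d + 1) N * ∫ x, f x : ℝ) : ℂ) - P‖ ≤ C * (N : ℝ)⁻¹ := by
    rw [hdiff, norm_mul, Complex.norm_real, Real.norm_eq_abs, abs_of_nonneg (by positivity)]
    have hC : 0 ≤ C * ((N : ℝ) ^ (d + 1))⁻¹ := (norm_nonneg _).trans (h1 0)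
    have h4 : ((XX (d + 1) N).card : ℝ) ≤ (N : ℝ) ^ (d + 1) := by exact_mod_cast card_XX_le (d + 1) N
    calc _ ≤ 1 / (N : ℝ) * ∑ x ∈ XX (d + 1) N, C * ((N : ℝ) ^ (d + 1))⁻¹ := by
          gcongr
          exact norm_sum_le_of_le _ fun x _ => h1 _
      _ = 1 / (N : ℝ) * ((XX (d + 1) N).card * (C * ((N : ℝ) ^ (d + 1))⁻¹)) := by
          rw [Finset.sum_const, nsmul_eq_mul]
      _ ≤ 1 / (N : ℝ) * ((N : ℝ) ^ (d + 1) * (C * ((N : ℝ) ^ (d + 1))⁻¹)) := by gcongr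
      _ = _ := by field_simp
  have h5 : ∀ x : ℝ, |x| = ‖(x : ℂ)‖ := fun x => by rw [Complex.norm_real, Real.norm_eq_abs]
  rw [h5]
  calc _ = ‖P + (((corrSum (d + 1) N (fun n => α * a n) f - Ck (d + 1) N * ∫ x, f x : ℝ) : ℂ) - P)‖ := by
        congr 1; ring
    _ ≤ _ := (norm_add_le _ _).trans (by gcongr)

theorem rho_bound (ρ : ℝ → ℝ) (hρ1 : Continuous ρ) (hρ2 : HasCompactSupport ρ) :
    ∃ C : ℝ, 0 < C ∧ ∀ α, ρ α ≤ C * Real.exp (-Real.pi * α ^ 2) := by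
  obtain ⟨C, hC⟩ := (hρ2.mul_right (f' := fun α => Real.exp (Real.pi * α ^ 2))).exists_bound_of_continuous
    (by fun_prop : Continuous fun α => ρ α * Real.exp (Real.pi * α ^ 2))
  refine ⟨|C| + 1, by positivity, fun α => ?_⟩
  have h1 : ρ α * Real.exp (Real.pi * α ^ 2) ≤ |C| + 1 := by
    have h2 := hC α
    have h3 := le_abs_self C
    have h4 := Real.le_norm_self (ρ α * Real.exp (Real.pi * α ^ 2))
    simp only [Pi.mul_apply] at h2
    linarith
  rw [neg_mul, Real.exp_neg, ← div_eq_mul_inv, le_div_iff₀ (Real.exp_pos _)]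
  exact h1

theorem core (c : ℝ) (a : ℕ → ℝ) (h : Lacu c a) (d : ℕ)
    (f : (Fin d → ℝ) → ℝ) (hf1 : ContDiff ℝ (⊤ : ℕ∞) f) (hf2 : HasCompactSupport f)
    (ρ : ℝ → ℝ) (hρ1 : Continuous ρ) (hρ2 : HasCompactSupport ρ) (hρ3 : ∀ x, 0 ≤ ρ x)
    (η : ℝ) (hη : 0 < η) :
    ∃ K : ℝ, 0 < K ∧ ∀ N : ℕ, 1 ≤ N →
      (∫ α : ℝ, (corrSum (d + 1) N (fun n => α * a n) f -
          Ck (d + 1) N * ∫ x : Fin d → ℝ, f x) ^ 2 * ρ α) ≤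
        K * (N : ℝ) ^ (-1 + η) := by
  set k : ℝ := ((d + 1 : ℕ) : ℝ) with hk
  have hk0 : 0 < k := by positivity
  set ε : ℝ := min 1 (η / (4 * k)) with hεd
  have hε : 0 < ε := lt_min one_pos (by positivity)
  have hε1 : ε ≤ 1 := min_le_left _ _
  have hε2 : 4 * k * ε ≤ η := by
    have : ε ≤ η / (4 * k) := min_le_right _ _
    rwa [le_div_iff₀ (by positivity), mul_comm] at this
  obtain ⟨C, hC, hfa⟩ := fourier_approx f hf1 hf2 ε hε (d + 1)
  obtain ⟨K, hK, hgs⟩ := gauss_sum_bound h d ε hε hε1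
  obtain ⟨Cρ, hCρ, hρ⟩ := rho_bound ρ hρ1 hρ2
  refine ⟨Cρ * 2 * (C ^ 2 * K) + Cρ * 2 * C ^ 2, by positivity, fun N hN => ?_⟩
  have hN1 : (1 : ℝ) ≤ N := by exact_mod_cast hN
  have hN0 : (0 : ℝ) < N := by positivity
  obtain ⟨coef, hc0, hcb, hca⟩ := hfa N hN
  set W := ⌈(N : ℝ) ^ (1 + ε)⌉₊ with hW
  have hpt := pointwise d N hN a f hf2 W C coef hc0 hca
  have hl2 := l2_bound (XX (d + 1) N ×ˢ BB d W) (fun p => (((N : ℝ)⁻¹ : ℝ) : ℂ) * coef p.2) (om a)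
    (C * ((N : ℝ) ^ (d + 1))⁻¹) (by
      intro p _
      rw [norm_mul, Complex.norm_real, Real.norm_eq_abs, abs_of_nonneg (by positivity)]
      calc (N : ℝ)⁻¹ * ‖coef p.2‖ ≤ (N : ℝ)⁻¹ * (C * ((N : ℝ) ^ d)⁻¹) := by gcongr; exact hcb _
        _ = _ := by rw [pow_succ, mul_inv]; ring)
  have hg := hgs N hN
  set P : ℝ → ℝ := fun α => ‖∑ p ∈ XX (d + 1) N ×ˢ BB d W, (((N : ℝ)⁻¹ : ℝ) * coef p.2) *
        Complex.exp ((2 * Real.pi * (α * om a p) : ℝ) * Complex.I)‖ with hP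
  have hexp : Integrable (fun α : ℝ => Real.exp (-Real.pi * α ^ 2)) := integrable_exp_neg_mul_sq Real.pi_pos
  have hone : ∫ α : ℝ, Real.exp (-Real.pi * α ^ 2) = 1 := by
    rw [integral_gaussian, div_self Real.pi_pos.ne', Real.sqrt_one]
  have hstep : ∫ α : ℝ, (corrSum (d + 1) N (fun n => α * a n) f -
          Ck (d + 1) N * ∫ x : Fin d → ℝ, f x) ^ 2 * ρ α ≤
      ∫ α : ℝ, (Cρ * 2 * (P α ^ 2 * Real.exp (-Real.pi * α ^ 2)) +
        Cρ * 2 * (C * (N : ℝ)⁻¹) ^ 2 * Real.exp (-Real.pi * α ^ 2)) := by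
    refine integral_mono_of_nonneg ?_ ?_ ?_
    · exact Eventually.of_forall fun α => mul_nonneg (sq_nonneg _) (hρ3 α)
    · exact (hl2.1.const_mul _).add (hexp.const_mul _)
    · refine Eventually.of_forall fun α => ?_
      have h1 := hpt α
      have h2 : (corrSum (d + 1) N (fun n => α * a n) f - Ck (d + 1) N * ∫ x : Fin d → ℝ, f x) ^ 2 ≤
          2 * P α ^ 2 + 2 * (C * (N : ℝ)⁻¹) ^ 2 := by
        rw [← sq_abs]
        calc _ ≤ (P α + C * (N : ℝ)⁻¹) ^ 2 := by gcongr
          _ ≤ _ := by nlinarith [sq_nonneg (P α - C * (N : ℝ)⁻¹)]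
      calc _ ≤ (2 * P α ^ 2 + 2 * (C * (N : ℝ)⁻¹) ^ 2) * (Cρ * Real.exp (-Real.pi * α ^ 2)) :=
            mul_le_mul h2 (hρ α) (hρ3 α) (by positivity)
        _ = _ := by ring
  refine hstep.trans ?_
  rw [integral_add (hl2.1.const_mul _) (hexp.const_mul _), integral_const_mul, integral_const_mul, hone, mul_one,
    add_mul]
  have hE1 : (N : ℝ) ^ (-1 + 4 * k * ε) ≤ (N : ℝ) ^ (-1 + η) :=
    Real.rpow_le_rpow_of_exponent_le hN1 (by linarith)
  have hE2 : ((N : ℝ)⁻¹) ^ 2 ≤ (N : ℝ) ^ (-1 + η) := by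
    rw [inv_pow, ← Real.rpow_natCast, ← Real.rpow_neg hN0.le]
    refine Real.rpow_le_rpow_of_exponent_le hN1 ?_
    push_cast
    linarith
  have hmain : ∫ α : ℝ, P α ^ 2 * Real.exp (-Real.pi * α ^ 2) ≤ C ^ 2 * K * (N : ℝ) ^ (-1 + η) := by
    refine hl2.2.trans ?_
    calc _ ≤ (C * ((N : ℝ) ^ (d + 1))⁻¹) ^ 2 * (K * (N : ℝ) ^ (2 * k - 1 + 4 * k * ε)) := by gcongr
      _ = C ^ 2 * K * (((N : ℝ) ^ (d + 1))⁻¹ ^ 2 * (N : ℝ) ^ (2 * k - 1 + 4 * k * ε)) := by ring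
      _ = C ^ 2 * K * (N : ℝ) ^ (-1 + 4 * k * ε) := by
          rw [inv_pow, ← pow_mul, ← Real.rpow_natCast (N : ℝ), ← Real.rpow_neg hN0.le, ← Real.rpow_add hN0]
          congr 2
          rw [hk]
          push_cast
          ring
      _ ≤ _ := by gcongr
  have h1 : Cρ * 2 * ∫ α : ℝ, P α ^ 2 * Real.exp (-Real.pi * α ^ 2) ≤ Cρ * 2 * (C ^ 2 * K * (N : ℝ) ^ (-1 + η)) := by
    gcongr
  have h2 : Cρ * 2 * (C * (N : ℝ)⁻¹) ^ 2 ≤ Cρ * 2 * C ^ 2 * (N : ℝ) ^ (-1 + η) := by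
    rw [mul_pow, ← mul_assoc]
    gcongr
  refine (add_le_add h1 h2).trans (le_of_eq ?_)
  ring

end Lac

theorem stmt9 (c : ℝ) (hc : 1 < c) (a : ℕ → ℝ) (ha1 : 0 < a 1)
    (hpos : ∀ n ≥ 1, 0 < a n) (hlac : ∀ n ≥ 1, c * a n ≤ a (n + 1))
    (k : ℕ) (hk : 2 ≤ k)
    (f : (Fin (k - 1) → ℝ) → ℝ) (hf1 : ContDiff ℝ (⊤ : ℕ∞) f) (hf2 : HasCompactSupport f)
    (ρ : ℝ → ℝ) (hρ1 : ContDiff ℝ (⊤ : ℕ∞) ρ) (hρ2 : HasCompactSupport ρ) (hρ3 : ∀ x, 0 ≤ ρ x)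
    (η : ℝ) (hη : 0 < η) :
    ∃ K : ℝ, 0 < K ∧ ∀ N : ℕ, 1 ≤ N →
      (∫ α : ℝ, (corrSum k N (fun n => α * a n) f -
          Ck k N * ∫ x : Fin (k - 1) → ℝ, f x) ^ 2 * ρ α) ≤
        K * (N : ℝ) ^ (-1 + η) := by
  obtain ⟨d, rfl⟩ : ∃ d, k = d + 1 := ⟨k - 1, by omega⟩
  exact Lac.core c a ⟨hc, hpos, hlac⟩ d f hf1 hf2 ρ hρ1.continuous hρ2 hρ3 η hη
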